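/- arXiv:1207.6182 — 11 statements merged into one kernel-verified Lean document; each statement's English description precedes it below -/
import Mathlib

section
/- Let X be a pure d-dimensional simplicial complex whose dual graph Λ(X) is a tree. Then f_0(X) ≤ f_d(X) + d. -/
variable {V : Type*} [DecidableEq V]

/-- The number of faces of the complex with facet set `F` having exactly `k` vertices
(i.e. of dimension `k - 1`). -/
def faceCount (F : Finset (Finset V)) (k : ℕ) : ℕ :=
  (F.biUnion fun σ => σ.powersetCard k).card

/-- The vertex set of the complex with facet set `F`. -/
def vertexSet (F : Finset (Finset V)) : Finset V := F.biUnion id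

/-- The dual graph of a pure `d`-dimensional complex given by its facet set `F`:
two facets are adjacent iff their intersection has `d` vertices (dimension `d-1`). -/
def dualGraph (d : ℕ) (F : Finset (Finset V)) : SimpleGraph {σ // σ ∈ F} where
  Adj σ τ := σ ≠ τ ∧ (σ.1 ∩ τ.1).card = d
  symm := ⟨fun σ τ h => ⟨h.1.symm, by rw [Finset.inter_comm]; exact h.2⟩⟩
  loopless := ⟨fun σ h => h.1 rfl⟩

/-- `IsStackedBall d F` : the pure `d`-dimensional complex with facet set `F` is a
stacked `d`-ball, i.e. it is obtained from a single `d`-simplex by repeatedly gluing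
a new `d`-simplex `σ` along a single `(d-1)`-face `τ` lying in exactly one facet of the previous complex
(so that the intersection of the old complex with the new simplex is exactly `τ̄`). -/
inductive IsStackedBall : ℕ → Finset (Finset V) → Prop
  | single (d : ℕ) (σ : Finset V) (h : σ.card = d + 1) : IsStackedBall d {σ}
  | glue (d : ℕ) (F : Finset (Finset V)) (σ τ : Finset V) :
      IsStackedBall d F → σ.card = d + 1 → σ ∉ F → τ ⊆ σ → τ.card = d →
      (∃! ρ, ρ ∈ F ∧ τ ⊆ ρ) → (∀ ρ ∈ F, ρ ∩ σ ⊆ τ) → IsStackedBall d (insert σ F)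

/-- The facet set of the link of the vertex `x` in the pure complex with facet set `F`. -/
def linkFacets (F : Finset (Finset V)) (x : V) : Finset (Finset V) :=
  (F.filter fun σ => x ∈ σ).image fun σ => σ.erase x

/-- The facet set of the boundary of a pure `d`-dimensional weak pseudomanifold with
facet set `F` : the `d`-element subsets of facets lying in exactly one facet. -/
def bdryFacets (d : ℕ) (F : Finset (Finset V)) : Finset (Finset V) :=
  (F.biUnion fun σ => σ.powersetCard d).filter fun τ => (F.filter fun σ => τ ⊆ σ).card = 1

/-- A complex (given by its facet set `S`) is a stacked `d`-sphere if it is the boundary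
of a stacked `(d+1)`-ball. -/
def IsStackedSphere (d : ℕ) (S : Finset (Finset V)) : Prop :=
  ∃ B : Finset (Finset V), IsStackedBall (d + 1) B ∧ S = bdryFacets (d + 1) B

/-- If `X` is a pure `d`-dimensional simplicial complex whose dual graph
`Λ(X)` is a tree, then `f₀(X) ≤ f_d(X) + d`. Here the pure complex is given by its facet
set `F` (all of cardinality `d+1`), `f₀(X)` is the number of vertices and `f_d(X) = |F|`. -/
theorem stmt0 (d : ℕ) (F : Finset (Finset V)) (hne : F.Nonempty)
    (hpure : ∀ σ ∈ F, σ.card = d + 1)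
    (htree : (dualGraph d F).IsTree) :
    (vertexSet F).card ≤ F.card + d := by
  classical
  obtain ⟨r, hr⟩ := hne
  have hconn := htree.connected
  have hpred : ∀ σ : {σ // σ ∈ F}, ∃ τ : {σ // σ ∈ F}, σ ≠ ⟨r, hr⟩ →
      (dualGraph d F).Adj σ τ ∧
        (dualGraph d F).dist τ ⟨r, hr⟩ < (dualGraph d F).dist σ ⟨r, hr⟩ := by
    intro σ
    obtain ⟨p, hp⟩ := hconn.exists_walk_length_eq_dist σ ⟨r, hr⟩
    cases p with
    | nil => exact ⟨⟨r, hr⟩, fun h => absurd rfl h⟩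
    | @cons _ τ _ h q =>
      refine ⟨τ, fun _ => ⟨h, ?_⟩⟩
      have := SimpleGraph.dist_le q
      rw [SimpleGraph.Walk.length_cons] at hp
      omega
  choose f hf using hpred
  let U : Finset V := r ∪ (Finset.univ.erase (⟨r, hr⟩ : {σ // σ ∈ F})).biUnion
    (fun σ => σ.1 \ (f σ).1)
  have hU : ∀ n : ℕ, ∀ σ : {σ // σ ∈ F}, (dualGraph d F).dist σ ⟨r, hr⟩ = n → σ.1 ⊆ U := by
    intro n
    induction n using Nat.strong_induction_on with
    | _ n ih =>
      intro σ hσ v hv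
      by_cases h : σ = ⟨r, hr⟩
      · subst h
        exact Finset.mem_union_left _ hv
      · by_cases hv2 : v ∈ (f σ).1
        · exact ih _ (hσ ▸ (hf σ h).2) (f σ) rfl hv2
        · apply Finset.mem_union_right
          rw [Finset.mem_biUnion]
          exact ⟨σ, Finset.mem_erase.2 ⟨h, Finset.mem_univ _⟩, Finset.mem_sdiff.2 ⟨hv, hv2⟩⟩
  have hsub : vertexSet F ⊆ U := by
    intro v hv
    obtain ⟨σ, hσ, hv⟩ := Finset.mem_biUnion.1 hv
    exact hU _ ⟨σ, hσ⟩ rfl hv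
  have hcard : ((Finset.univ.erase (⟨r, hr⟩ : {σ // σ ∈ F})).biUnion
      (fun σ => σ.1 \ (f σ).1)).card ≤ (F.card - 1) * 1 := by
    have := Finset.card_biUnion_le_card_mul (Finset.univ.erase (⟨r, hr⟩ : {σ // σ ∈ F}))
      (fun σ => σ.1 \ (f σ).1) 1 (by
        intro σ hσ
        have h1 := (hf σ (Finset.mem_erase.1 hσ).1).1.2
        have h2 := Finset.card_sdiff_add_card_inter σ.1 (f σ).1
        have h3 := hpure σ.1 σ.2
        change (σ.1 \ (f σ).1).card ≤ 1
        omega)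
    simpa [Finset.card_erase_of_mem] using this
  have h1 := Finset.card_le_card hsub
  have h2 : U.card ≤ _ := Finset.card_union_le _ _
  have h3 := hpure r hr
  have h4 : 0 < F.card := Finset.card_pos.2 ⟨r, hr⟩
  omega
end

section
/- Let X be a pure d-dimensional simplicial complex. If the dual graph Λ(X) is a tree and f_0(X) = f_d(X) + d, then X is a stacked d-ball. -/
variable {V : Type*} [DecidableEq V]

theorem stmt2_tree_erase (d : ℕ) (F : Finset (Finset V)) (σ : {σ // σ ∈ F})
    [Fintype ((dualGraph d F).neighborSet σ)]
    (htree : (dualGraph d F).IsTree) (hdeg : (dualGraph d F).degree σ = 1) :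
    (dualGraph d (F.erase σ.1)).IsTree := by
  have hT : ((dualGraph d F).induce {σ}ᶜ).IsTree :=
    ⟨htree.1.induce_compl_singleton_of_degree_eq_one hdeg, htree.2.induce _⟩
  let e : dualGraph d (F.erase σ.1) ≃g (dualGraph d F).induce {σ}ᶜ :=
    { toFun := fun ρ => ⟨⟨ρ.1, Finset.mem_of_mem_erase ρ.2⟩, by
        intro h
        exact Finset.ne_of_mem_erase ρ.2 (congrArg Subtype.val h)⟩
      invFun := fun ρ => ⟨ρ.1.1, Finset.mem_erase.2 ⟨fun h => ρ.2 (Subtype.ext h), ρ.1.2⟩⟩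
      left_inv := fun _ => rfl
      right_inv := fun _ => rfl
      map_rel_iff' := by
        intro a b
        constructor
        · rintro ⟨h1, h2⟩
          exact ⟨fun h => h1 (by subst h; rfl), h2⟩
        · rintro ⟨h1, h2⟩
          exact ⟨fun h => h1 (Subtype.ext (by have h3 := congrArg Subtype.val h; exact h3)), h2⟩ }
  exact e.isTree_iff.2 hT

theorem stmt2_aux (d : ℕ) (n : ℕ) : ∀ (F : Finset (Finset V)), F.card = n + 1 →
    (∀ σ ∈ F, σ.card = d + 1) → (dualGraph d F).IsTree →
    (vertexSet F).card ≤ F.card + d ∧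
      ((vertexSet F).card = F.card + d → IsStackedBall d F) := by
  classical
  induction n with
  | zero =>
    intro F hF hpure _
    obtain ⟨σ, rfl⟩ := Finset.card_eq_one.1 hF
    have h := hpure σ (by simp)
    refine ⟨?_, fun _ => .single d σ h⟩
    rw [hF]; simp [vertexSet, h]; try omega
  | succ n ih =>
    intro F hF hpure htree
    haveI : Nontrivial {σ // σ ∈ F} := by
      rw [← Fintype.one_lt_card_iff_nontrivial]
      simp [hF]
    obtain ⟨σ, hσ⟩ := htree.exists_vert_degree_one_of_nontrivial
    have hT := stmt2_tree_erase d F σ htree hσ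
    obtain ⟨ρ, hadj, huniq⟩ := SimpleGraph.degree_eq_one_iff_existsUnique_adj.1 hσ
    have hc : (F.erase σ.1).card = n + 1 := by
      rw [Finset.card_erase_of_mem σ.2, hF]; rfl
    obtain ⟨hle, hst⟩ := ih (F.erase σ.1) hc
      (fun τ hτ => hpure τ (Finset.mem_of_mem_erase hτ)) hT
    have hins : insert σ.1 (F.erase σ.1) = F := Finset.insert_erase σ.2
    have hV : vertexSet F = σ.1 ∪ vertexSet (F.erase σ.1) := by
      conv_lhs => rw [← hins]
      unfold vertexSet
      rw [Finset.biUnion_insert]; rfl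
    have hρne : ρ.1 ≠ σ.1 := fun h => hadj.1 (Subtype.ext h.symm)
    have hρV : ρ.1 ⊆ vertexSet (F.erase σ.1) :=
      Finset.subset_biUnion_of_mem id (Finset.mem_erase.2 ⟨hρne, ρ.2⟩)
    have hσc := hpure σ.1 σ.2
    have hτc : (σ.1 ∩ ρ.1).card = d := hadj.2
    have hsub : σ.1 ∩ ρ.1 ⊆ σ.1 ∩ vertexSet (F.erase σ.1) :=
      Finset.inter_subset_inter_left hρV
    have h1 := Finset.card_le_card hsub
    have h2 := Finset.card_union_add_card_inter σ.1 (vertexSet (F.erase σ.1))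
    rw [← hV] at h2
    refine ⟨by omega, fun heq => ?_⟩
    have hball := hst (by omega)
    have hEq : σ.1 ∩ ρ.1 = σ.1 ∩ vertexSet (F.erase σ.1) :=
      Finset.eq_of_subset_of_card_le hsub (by omega)
    have hint : ∀ π ∈ F.erase σ.1, π ∩ σ.1 ⊆ σ.1 ∩ ρ.1 := by
      intro π hπ
      rw [hEq, Finset.inter_comm]
      exact Finset.inter_subset_inter_left (Finset.subset_biUnion_of_mem id hπ)
    rw [← hins]
    refine .glue d _ σ.1 (σ.1 ∩ ρ.1) hball hσc (Finset.notMem_erase _ _)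
      Finset.inter_subset_left hτc ?_ hint
    refine ⟨ρ.1, ⟨Finset.mem_erase.2 ⟨hρne, ρ.2⟩, Finset.inter_subset_right⟩, ?_⟩
    rintro π ⟨hπ, hsubπ⟩
    have hπF := Finset.mem_of_mem_erase hπ
    have e1 : σ.1 ∩ π = σ.1 ∩ ρ.1 := by
      apply Finset.Subset.antisymm
      · rw [Finset.inter_comm]; exact hint π hπ
      · exact Finset.subset_inter Finset.inter_subset_left hsubπ
    have := huniq ⟨π, hπF⟩ ⟨fun h => Finset.ne_of_mem_erase hπ (congrArg Subtype.val h).symm, by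
      show (σ.1 ∩ π).card = d
      rw [e1, hτc]⟩
    exact congrArg Subtype.val this

/-- Let `X` be a pure `d`-dimensional simplicial complex. If the dual
graph `Λ(X)` is a tree and `f₀(X) = f_d(X) + d`, then `X` is a stacked `d`-ball. -/
theorem stmt2 (d : ℕ) (F : Finset (Finset V)) (hne : F.Nonempty)
    (hpure : ∀ σ ∈ F, σ.card = d + 1)
    (htree : (dualGraph d F).IsTree)
    (hcard : (vertexSet F).card = F.card + d) :
    IsStackedBall d F := by
  obtain ⟨n, hn⟩ := Nat.exists_eq_succ_of_ne_zero hne.card_pos.ne'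
  exact (stmt2_aux d n F hn hpure htree).2 hcard
end

section
/- Let X be a pure d-dimensional simplicial complex and let CX denote a cone over X (the join of X with one new vertex not in X). Then CX is a stacked (d+1)-ball if and only if X is a stacked d-ball. -/
variable {V : Type*} [DecidableEq V]

theorem cone_of_ball (v : V) {d : ℕ} {F : Finset (Finset V)} (h : IsStackedBall d F) :
    (∀ ρ ∈ F, v ∉ ρ) → IsStackedBall (d + 1) (F.image (insert v)) := by
  induction h with
  | single σ h =>
    intro hv
    rw [Finset.image_singleton]
    refine IsStackedBall.single _ _ ?_
    rw [Finset.card_insert_of_notMem (hv σ (by simp)), h]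
  | glue F σ τ hF hσ hσF hτσ hτ hu hint ih =>
    intro hv
    have hvF : ∀ ρ ∈ F, v ∉ ρ := fun ρ hρ => hv ρ (Finset.mem_insert_of_mem hρ)
    have hvσ : v ∉ σ := hv σ (Finset.mem_insert_self _ _)
    have hvτ : v ∉ τ := fun h => hvσ (hτσ h)
    rw [Finset.image_insert]
    refine IsStackedBall.glue _ _ _ (insert v τ) (ih hvF) ?_ ?_ ?_ ?_ ?_ ?_
    · rw [Finset.card_insert_of_notMem hvσ, hσ]
    · intro hm
      obtain ⟨ρ, hρ, he⟩ := Finset.mem_image.1 hm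
      have h2 : ρ = σ := by
        rw [← Finset.erase_insert (hvF ρ hρ), he, Finset.erase_insert hvσ]
      exact hσF (h2 ▸ hρ)
    · exact Finset.insert_subset_insert _ hτσ
    · rw [Finset.card_insert_of_notMem hvτ, hτ]
    · obtain ⟨ρ, ⟨hρ, hτρ⟩, huniq⟩ := hu
      refine ⟨insert v ρ, ⟨Finset.mem_image_of_mem _ hρ, Finset.insert_subset_insert _ hτρ⟩, ?_⟩
      rintro y ⟨hy, hty⟩
      obtain ⟨ρ', hρ', rfl⟩ := Finset.mem_image.1 hy
      rw [huniq ρ' ⟨hρ', (Finset.insert_subset_insert_iff hvτ).1 hty⟩]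
    · intro y hy
      obtain ⟨ρ', hρ', rfl⟩ := Finset.mem_image.1 hy
      rw [← Finset.insert_inter_distrib]
      exact Finset.insert_subset_insert _ (hint ρ' hρ')

theorem ball_of_cone (v : V) {n : ℕ} {G : Finset (Finset V)} (h : IsStackedBall n G) :
    ∀ d, n = d + 1 → (∀ ρ ∈ G, v ∈ ρ) → IsStackedBall d (G.image fun ρ => ρ.erase v) := by
  induction h with
  | single σ h =>
    intro d hd hv
    rw [Finset.image_singleton]
    refine IsStackedBall.single _ _ ?_
    rw [Finset.card_erase_of_mem (hv σ (by simp))]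
    omega
  | glue F σ τ hF hσ hσF hτσ hτ hu hint ih =>
    intro d hd hv
    have hvF : ∀ ρ ∈ F, v ∈ ρ := fun ρ hρ => hv ρ (Finset.mem_insert_of_mem hρ)
    have hvσ : v ∈ σ := hv σ (Finset.mem_insert_self _ _)
    obtain ⟨ρ, ⟨hρ, hτρ⟩, huniq⟩ := hu
    have hvτ : v ∈ τ := hint ρ hρ (Finset.mem_inter.2 ⟨hvF ρ hρ, hvσ⟩)
    rw [Finset.image_insert]
    refine IsStackedBall.glue _ _ _ (τ.erase v) (ih d hd hvF) ?_ ?_ ?_ ?_ ?_ ?_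
    · rw [Finset.card_erase_of_mem hvσ]; omega
    · intro hm
      obtain ⟨ρ, hρ, he⟩ := Finset.mem_image.1 hm
      have h2 : ρ = σ := by
        rw [← Finset.insert_erase (hvF ρ hρ), he, Finset.insert_erase hvσ]
      exact hσF (h2 ▸ hρ)
    · exact Finset.erase_subset_erase _ hτσ
    · rw [Finset.card_erase_of_mem hvτ]; omega
    · refine ⟨ρ.erase v, ⟨Finset.mem_image_of_mem _ hρ, Finset.erase_subset_erase _ hτρ⟩, ?_⟩
      rintro y ⟨hy, hty⟩
      obtain ⟨ρ', hρ', rfl⟩ := Finset.mem_image.1 hy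
      have : τ ⊆ ρ' := by
        rw [← Finset.insert_erase hvτ, ← Finset.insert_erase (hvF ρ' hρ')]
        exact Finset.insert_subset_insert _ hty
      rw [huniq ρ' ⟨hρ', this⟩]
    · intro y hy
      obtain ⟨ρ', hρ', rfl⟩ := Finset.mem_image.1 hy
      intro x hx
      simp only [Finset.mem_inter, Finset.mem_erase] at hx ⊢
      exact ⟨hx.1.1, hint ρ' hρ' (Finset.mem_inter.2 ⟨hx.1.2, hx.2.2⟩)⟩

/-- Let `X` be a pure `d`-dimensional simplicial complex and let `CX`
be the cone over `X` with apex a new vertex `v` not in `X` (its facets are the sets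
`σ ∪ {v}` for facets `σ` of `X`). Then `CX` is a stacked `(d+1)`-ball if and only if
`X` is a stacked `d`-ball. -/
theorem stmt3 (d : ℕ) (F : Finset (Finset V)) (hne : F.Nonempty)
    (hpure : ∀ σ ∈ F, σ.card = d + 1)
    (v : V) (hv : v ∉ vertexSet F) :
    IsStackedBall (d + 1) (F.image (insert v)) ↔ IsStackedBall d F := by
  have hvF : ∀ ρ ∈ F, v ∉ ρ := fun ρ hρ h =>
    hv (Finset.mem_biUnion.2 ⟨ρ, hρ, h⟩)
  constructor
  · intro h
    have h2 := ball_of_cone v h d rfl (by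
      intro ρ hρ
      obtain ⟨ρ', _, rfl⟩ := Finset.mem_image.1 hρ
      exact Finset.mem_insert_self _ _)
    have h3 : (F.image (insert v)).image (fun ρ => ρ.erase v) = F := by
      rw [Finset.image_image]
      conv_rhs => rw [← Finset.image_id (s := F)]
      exact Finset.image_congr fun ρ hρ => Finset.erase_insert (hvF ρ hρ)
    rwa [h3] at h2
  · intro h
    exact cone_of_ball v h hvF
end

section
/- Let d ≥ 4 and let M be a member of the class K̄(d+1), i.e., a (d+1)-dimensional simplicial complex all of whose vertex links are stacked d-balls. Then the automorphism group of M equals the automorphism group of its boundary ∂M: a permutation of the vertex set of M is an automorphism of M if and only if it is an automorphism of ∂M. -/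
variable {V : Type*} [DecidableEq V]

theorem aux_mem_bdry {k : ℕ} {F : Finset (Finset V)} {τ : Finset V} :
    τ ∈ bdryFacets k F ↔ τ.card = k ∧ ∃! ρ, ρ ∈ F ∧ τ ⊆ ρ := by
  unfold bdryFacets
  simp only [Finset.mem_filter, Finset.mem_biUnion, Finset.mem_powersetCard, Finset.card_eq_one]
  constructor
  · rintro ⟨⟨ρ, hρ, hτ, hc⟩, a, ha⟩
    refine ⟨hc, a, ?_, ?_⟩
    · have : a ∈ F.filter fun σ => τ ⊆ σ := by rw [ha]; simp
      simpa using this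
    · intro y hy
      have : y ∈ F.filter fun σ => τ ⊆ σ := by simpa using hy
      rw [ha] at this
      simpa using this
  · rintro ⟨hc, a, ha, hu⟩
    refine ⟨⟨a, ha.1, ha.2, hc⟩, a, ?_⟩
    ext y
    simp only [Finset.mem_filter, Finset.mem_singleton]
    constructor
    · exact hu y
    · rintro rfl
      exact ha

/-- Every face with at most `d-1` vertices of a stacked ball lies in a boundary face. -/
theorem aux_face_bdry {d : ℕ} {B : Finset (Finset V)} (h : IsStackedBall d B) :
    ∀ α : Finset V, α.card + 1 ≤ d → (∃ ρ ∈ B, α ⊆ ρ) →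
      ∃ τ, α ⊆ τ ∧ τ.card = d ∧ ∃! ρ, ρ ∈ B ∧ τ ⊆ ρ := by
  induction h with
  | single σ h =>
    rintro α hα ⟨ρ, hρ, hs⟩
    rw [Finset.mem_singleton] at hρ
    subst hρ
    obtain ⟨τ, h1, h2, h3⟩ := Finset.exists_subsuperset_card_eq hs (n := d) (by omega) (by omega)
    refine ⟨τ, h1, h3, ρ, ⟨by simp, h2⟩, ?_⟩
    rintro y ⟨hy, -⟩
    simpa using hy
  | glue F σ τ hF hσ hσF hτσ hτ hu hint ih =>
    intro α hα hex
    have key : α ⊆ σ → ∃ τ, α ⊆ τ ∧ τ.card = d ∧ ∃! ρ, ρ ∈ insert σ F ∧ τ ⊆ ρ := by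
      intro hs
      have : ∃ w ∈ τ, w ∉ α := by
        by_contra hcon
        push Not at hcon
        have := Finset.card_le_card (show τ ⊆ α from hcon)
        omega
      obtain ⟨w, hw, hwα⟩ := this
      have hcw : (σ.erase w).card = d := by
        rw [Finset.card_erase_of_mem (hτσ hw)]; omega
      refine ⟨σ.erase w, fun a ha => Finset.mem_erase.2 ⟨by rintro rfl; exact hwα ha, hs ha⟩,
        hcw, σ, ⟨by simp, Finset.erase_subset _ _⟩, ?_⟩
      rintro y ⟨hy, hsub⟩
      rcases Finset.mem_insert.1 hy with rfl | hy
      · rfl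
      · exfalso
        have h1 : σ.erase w ⊆ τ := fun a ha =>
          hint y hy (Finset.mem_inter.2 ⟨hsub ha, Finset.mem_of_mem_erase ha⟩)
        have h2 := Finset.eq_of_subset_of_card_le h1 (by omega)
        rw [← h2] at hw
        simp at hw
    by_cases hασ : α ⊆ σ
    · exact key hασ
    · obtain ⟨ρ, hρ, hs⟩ := hex
      rcases Finset.mem_insert.1 hρ with rfl | hρ
      · exact absurd hs hασ
      · obtain ⟨τ', h1, h2, r, hr, hru⟩ := ih α hα ⟨ρ, hρ, hs⟩
        refine ⟨τ', h1, h2, r, ⟨Finset.mem_insert_of_mem hr.1, hr.2⟩, ?_⟩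
        rintro y ⟨hy, hsub⟩
        rcases Finset.mem_insert.1 hy with rfl | hy
        · exact absurd (h1.trans hsub) hασ
        · exact hru y ⟨hy, hsub⟩

/-- A stacked ball is a flag complex in top dimension. -/
theorem aux_clique {d : ℕ} {B : Finset (Finset V)} (h : IsStackedBall d B) :
    ∀ C : Finset V, 1 ≤ d → C.card = d + 1 →
      (∀ a ∈ C, ∀ b ∈ C, a ≠ b → ∃ ρ ∈ B, a ∈ ρ ∧ b ∈ ρ) → C ∈ B := by
  induction h with
  | single σ h =>
    intro C hd hC hp
    have : C ⊆ σ := by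
      intro a ha
      obtain ⟨b, hb, hab⟩ := Finset.exists_mem_ne (by omega : 1 < C.card) a
      obtain ⟨ρ, hρ, h1, -⟩ := hp a ha b hb hab.symm
      rw [Finset.mem_singleton] at hρ
      exact hρ ▸ h1
    rw [Finset.mem_singleton]
    exact Finset.eq_of_subset_of_card_le this (by omega)
  | glue F σ τ hF hσ hσF hτσ hτ hu hint ih =>
    intro C hd hC hp
    by_cases hv : ∃ v ∈ C, v ∈ σ ∧ v ∉ τ
    · obtain ⟨v, hvC, hvσ, hvτ⟩ := hv
      have : C ⊆ σ := by
        intro a ha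
        by_cases hav : a = v
        · exact hav ▸ hvσ
        obtain ⟨ρ, hρ, h1, h2⟩ := hp a ha v hvC hav
        rcases Finset.mem_insert.1 hρ with rfl | hρ
        · exact h1
        · exact absurd (hint ρ hρ (Finset.mem_inter.2 ⟨h2, hvσ⟩)) hvτ
      rw [Finset.eq_of_subset_of_card_le this (by omega)]
      simp
    · push Not at hv
      refine Finset.mem_insert_of_mem (ih C hd hC ?_)
      intro a ha b hb hab
      obtain ⟨ρ, hρ, h1, h2⟩ := hp a ha b hb hab
      rcases Finset.mem_insert.1 hρ with rfl | hρ
      · obtain ⟨r, hr, -⟩ := hu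
        exact ⟨r, hr.1, hr.2 (hv a ha h1), hr.2 (hv b hb h2)⟩
      · exact ⟨ρ, hρ, h1, h2⟩

theorem aux_mem_link {F : Finset (Finset V)} {x : V} {ρ : Finset V} :
    ρ ∈ linkFacets F x ↔ x ∉ ρ ∧ insert x ρ ∈ F := by
  unfold linkFacets
  simp only [Finset.mem_image, Finset.mem_filter]
  constructor
  · rintro ⟨σ, ⟨h1, h2⟩, rfl⟩
    exact ⟨by simp, by rwa [Finset.insert_erase h2]⟩
  · rintro ⟨h1, h2⟩
    exact ⟨_, ⟨h2, by simp⟩, Finset.erase_insert h1⟩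

theorem aux_char (d : ℕ) (hd : 4 ≤ d) (F : Finset (Finset V))
    (hpure : ∀ σ ∈ F, σ.card = (d + 1) + 1)
    (hlinks : ∀ x ∈ vertexSet F, IsStackedBall d (linkFacets F x)) (σ : Finset V) :
    σ ∈ F ↔ σ.card = d + 2 ∧ ∀ t ⊆ σ, t.card = 3 → ∃ τ ∈ bdryFacets (d + 1) F, t ⊆ τ := by
  constructor
  · intro hσ
    refine ⟨hpure σ hσ, fun t ht htc => ?_⟩
    obtain ⟨x, hx⟩ : t.Nonempty := Finset.card_pos.1 (by omega)
    have hxV : x ∈ vertexSet F := Finset.mem_biUnion.2 ⟨σ, hσ, ht hx⟩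
    obtain ⟨τ, h1, h2, r, ⟨hr, hτr⟩, hru⟩ := aux_face_bdry (hlinks x hxV) (t.erase x)
      (by rw [Finset.card_erase_of_mem hx]; omega)
      ⟨σ.erase x, aux_mem_link.2 ⟨by simp, by rwa [Finset.insert_erase (ht hx)]⟩,
        Finset.erase_subset_erase _ ht⟩
    obtain ⟨hxr, hrF⟩ := aux_mem_link.1 hr
    have hxτ : x ∉ τ := fun h => hxr (hτr h)
    refine ⟨insert x τ, aux_mem_bdry.2 ⟨by rw [Finset.card_insert_of_notMem hxτ, h2],
      insert x r, ⟨hrF, Finset.insert_subset_insert _ hτr⟩, ?_⟩, ?_⟩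
    · rintro y ⟨hy, hs⟩
      have hxy : x ∈ y := hs (by simp)
      rw [← hru (y.erase x) ⟨aux_mem_link.2 ⟨by simp, by rwa [Finset.insert_erase hxy]⟩, ?_⟩,
        Finset.insert_erase hxy]
      intro a ha
      exact Finset.mem_erase.2 ⟨by rintro rfl; exact hxτ ha, hs (by simp [ha])⟩
    · rw [← Finset.insert_erase hx]
      exact Finset.insert_subset_insert _ h1
  · rintro ⟨hc, ht⟩
    have tri : ∀ t ⊆ σ, t.card = 3 → ∃ ρ ∈ F, t ⊆ ρ := by
      intro t h1 h2
      obtain ⟨τ, hτ, hs⟩ := ht t h1 h2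
      obtain ⟨-, ρ, hρ, -⟩ := aux_mem_bdry.1 hτ
      exact ⟨ρ, hρ.1, hs.trans hρ.2⟩
    obtain ⟨x, hx⟩ : σ.Nonempty := Finset.card_pos.1 (by omega)
    have hxV : x ∈ vertexSet F := by
      obtain ⟨t, h1, h2, h3⟩ := Finset.exists_subsuperset_card_eq
        (Finset.singleton_subset_iff.2 hx) (n := 3) (by simp) (by omega)
      obtain ⟨ρ, hρ, hs⟩ := tri t h2 h3
      exact Finset.mem_biUnion.2 ⟨ρ, hρ, hs (h1 (by simp))⟩
    have := aux_clique (hlinks x hxV) (σ.erase x) (by omega)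
      (by rw [Finset.card_erase_of_mem hx]; omega) ?_
    · have := (aux_mem_link.1 this).2
      rwa [Finset.insert_erase hx] at this
    · intro a ha b hb hab
      rw [Finset.mem_erase] at ha hb
      obtain ⟨ρ, hρ, hs⟩ := tri {x, a, b}
        (by intro z hz; simp at hz; rcases hz with rfl | rfl | rfl <;> tauto)
        (Finset.card_eq_three.2 ⟨x, a, b, ha.1.symm, hb.1.symm, hab, rfl⟩)
      have hxρ : x ∈ ρ := hs (by simp)
      exact ⟨ρ.erase x, aux_mem_link.2 ⟨by simp, by rwa [Finset.insert_erase hxρ]⟩,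
        Finset.mem_erase.2 ⟨ha.1, hs (by simp)⟩, Finset.mem_erase.2 ⟨hb.1, hs (by simp)⟩⟩

theorem aux_surj (π : Equiv.Perm V) (τ : Finset V) : ∃ s : Finset V, s.image π = τ :=
  ⟨τ.image π.symm, by rw [Finset.image_image]; simp⟩

/-- Let `d ≥ 4` and let `M` be a member of `K̄(d+1)`, i.e. a pure
`(d+1)`-dimensional simplicial complex all of whose vertex links are stacked `d`-balls.
Then `Aut(M) = Aut(∂M)`: a permutation `π` of the vertex set is an automorphism of `M`
(maps facets to facets, bijectively) if and only if it is an automorphism of the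
boundary complex `∂M`. -/
theorem stmt4 (d : ℕ) (hd : 4 ≤ d) (F : Finset (Finset V)) (hne : F.Nonempty)
    (hpure : ∀ σ ∈ F, σ.card = (d + 1) + 1)
    (hlinks : ∀ x ∈ vertexSet F, IsStackedBall d (linkFacets F x))
    (π : Equiv.Perm V) :
    (∀ σ : Finset V, σ ∈ F ↔ σ.image π ∈ F) ↔
      (∀ τ : Finset V, τ ∈ bdryFacets (d + 1) F ↔ τ.image π ∈ bdryFacets (d + 1) F) := by
  have hsub : ∀ s t : Finset V, s.image π ⊆ t.image π ↔ s ⊆ t := fun s t =>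
    Finset.image_subset_image_iff π.injective
  have hcard : ∀ s : Finset V, (s.image π).card = s.card := fun s =>
    Finset.card_image_of_injective _ π.injective
  constructor
  · intro h τ
    rw [aux_mem_bdry, aux_mem_bdry, hcard]
    refine and_congr_right fun _ => ?_
    constructor
    · rintro ⟨r, ⟨h1, h2⟩, hu⟩
      refine ⟨r.image π, ⟨(h r).1 h1, (hsub _ _).2 h2⟩, ?_⟩
      rintro y ⟨hy1, hy2⟩
      obtain ⟨s, rfl⟩ := aux_surj π y
      rw [hu s ⟨(h s).2 hy1, (hsub _ _).1 hy2⟩]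
    · rintro ⟨r, ⟨h1, h2⟩, hu⟩
      obtain ⟨r, rfl⟩ := aux_surj π r
      refine ⟨r, ⟨(h r).2 h1, (hsub _ _).1 h2⟩, ?_⟩
      rintro y ⟨hy1, hy2⟩
      exact Finset.image_injective π.injective
        (hu (y.image π) ⟨(h y).1 hy1, (hsub _ _).2 hy2⟩)
  · intro h σ
    rw [aux_char d hd F hpure hlinks, aux_char d hd F hpure hlinks, hcard]
    refine and_congr_right fun _ => ?_
    constructor
    · intro H t ht htc
      obtain ⟨t, rfl⟩ := aux_surj π t
      obtain ⟨τ, hτ, hs⟩ := H t ((hsub _ _).1 ht) (by rw [← hcard, htc])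
      exact ⟨τ.image π, (h τ).1 hτ, (hsub _ _).2 hs⟩
    · intro H t ht htc
      obtain ⟨τ, hτ, hs⟩ := H (t.image π) ((hsub _ _).2 ht) (by rw [hcard, htc])
      obtain ⟨τ, rfl⟩ := aux_surj π τ
      exact ⟨τ, (h τ).2 hτ, (hsub _ _).1 hs⟩
end

section
/- Let N be a member of the class K̄(d), i.e., a d-dimensional simplicial complex all of whose vertex links are stacked (d-1)-balls. Then the (d-2)-skeleton of N equals the (d-2)-skeleton of its boundary ∂N; that is, every face of N of dimension at most d-2 is a face of ∂N. -/
variable {V : Type*} [DecidableEq V]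

theorem stackedBall_bdry {V : Type*} [DecidableEq V] (e : ℕ) (F : Finset (Finset V))
    (h : IsStackedBall e F) : ∀ t : Finset V, t.card + 1 ≤ e → (∃ σ ∈ F, t ⊆ σ) →
      ∃ β : Finset V, β.card = e ∧ t ⊆ β ∧ ∃ ρ ∈ F, β ⊆ ρ ∧ ∀ ρ' ∈ F, β ⊆ ρ' → ρ' = ρ := by
  induction h with
  | single σ h =>
    rintro t ht ⟨σ', hσ', hs⟩
    obtain rfl := Finset.mem_singleton.1 hσ'
    obtain ⟨β, h1, h2, h3⟩ := Finset.exists_subsuperset_card_eq hs (n := e) (by omega) (by omega)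
    exact ⟨β, h3, h1, σ', hσ', h2, fun ρ' h _ => Finset.mem_singleton.1 h⟩
  | glue F σ τ hF hσ hσF hτ hτd hu hint ih =>
    rintro t ht ⟨σ', hσ', hs⟩
    by_cases hts : t ⊆ σ
    · obtain ⟨y, hy, hyt⟩ := Finset.exists_mem_notMem_of_card_lt_card (s := t) (t := τ) (by omega)
      have hc : (σ.erase y).card = e := by rw [Finset.card_erase_of_mem (hτ hy)]; omega
      refine ⟨σ.erase y, hc, fun a ha => Finset.mem_erase.2 ⟨fun h => hyt (h ▸ ha), hts ha⟩,
        σ, Finset.mem_insert_self _ _, Finset.erase_subset _ _, ?_⟩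
      intro ρ hρ hsub
      rcases Finset.mem_insert.1 hρ with h | h
      · exact h
      · exfalso
        have h1 : σ.erase y ⊆ τ := fun a ha =>
          hint ρ h (Finset.mem_inter.2 ⟨hsub ha, Finset.mem_of_mem_erase ha⟩)
        have h2 := Finset.eq_of_subset_of_card_le h1 (by omega)
        rw [← h2] at hy
        exact Finset.notMem_erase _ _ hy
    · have hσ'F : σ' ∈ F := by
        rcases Finset.mem_insert.1 hσ' with h | h
        · exact absurd (h ▸ hs) hts
        · exact h
      obtain ⟨β, h1, h2, ρ, h3, h4, h5⟩ := ih t ht ⟨σ', hσ'F, hs⟩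
      refine ⟨β, h1, h2, ρ, Finset.mem_insert_of_mem h3, h4, ?_⟩
      intro ρ' hρ' hsub
      rcases Finset.mem_insert.1 hρ' with h | h
      · exact absurd (h2.trans (h ▸ hsub)) hts
      · exact h5 ρ' h hsub

theorem stmt5 (d : ℕ) (F : Finset (Finset V)) (hne : F.Nonempty)
    (hpure : ∀ σ ∈ F, σ.card = d + 1)
    (hlinks : ∀ x ∈ vertexSet F, IsStackedBall (d - 1) (linkFacets F x)) :
    ∀ s : Finset V, s.Nonempty → (∃ σ ∈ F, s ⊆ σ) → s.card ≤ d - 1 →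
      ∃ τ ∈ bdryFacets d F, s ⊆ τ := by
  rintro s ⟨x, hx⟩ ⟨σ, hσ, hs⟩ hcard
  have hpos := Finset.card_pos.2 ⟨x, hx⟩
  have hlk : ∀ ρ ∈ F, x ∈ ρ → ρ.erase x ∈ linkFacets F x := fun ρ h1 h2 =>
    Finset.mem_image.2 ⟨ρ, Finset.mem_filter.2 ⟨h1, h2⟩, rfl⟩
  obtain ⟨β, h1, h2, ρ, h3, h4, h5⟩ := stackedBall_bdry _ _
    (hlinks x (Finset.mem_biUnion.2 ⟨σ, hσ, hs hx⟩)) (s.erase x)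
    (by rw [Finset.card_erase_of_mem hx]; omega)
    ⟨σ.erase x, hlk σ hσ (hs hx), Finset.erase_subset_erase _ hs⟩
  obtain ⟨ρ₀, hρ₀, rfl⟩ := Finset.mem_image.1 h3
  obtain ⟨hρF, hxρ⟩ := Finset.mem_filter.1 hρ₀
  have hxβ : x ∉ β := fun h => Finset.notMem_erase _ _ (h4 h)
  have hsub : insert x β ⊆ ρ₀ := Finset.insert_subset hxρ (h4.trans (Finset.erase_subset _ _))
  refine ⟨insert x β, Finset.mem_filter.2 ⟨Finset.mem_biUnion.2 ⟨ρ₀, hρF,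
    Finset.mem_powersetCard.2 ⟨hsub, ?_⟩⟩, Finset.card_eq_one.2 ⟨ρ₀, ?_⟩⟩, ?_⟩
  · rw [Finset.card_insert_of_notMem hxβ]; omega
  · ext ρ'
    simp only [Finset.mem_filter, Finset.mem_singleton]
    constructor
    · rintro ⟨ha, hb⟩
      have hx' : x ∈ ρ' := hb (Finset.mem_insert_self _ _)
      have := h5 _ (hlk ρ' ha hx') (fun a h => Finset.mem_erase.2
        ⟨fun e => hxβ (e ▸ h), hb (Finset.mem_insert_of_mem h)⟩)
      rw [← Finset.insert_erase hx', this, Finset.insert_erase hxρ]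
    · rintro rfl
      exact ⟨hρF, hsub⟩
  · rw [← Finset.insert_erase hx]
    exact Finset.insert_subset_insert _ h2
end

section
/- Let G be a graph and T = {T_1, …, T_n} a family of induced subtrees of G, each having exactly n − d vertices, such that (0) any two members of T have a common vertex, (i) each vertex of G lies in exactly d+1 members of T, and (ii) two distinct vertices u, v of G lie together in exactly d members of T if and only if uv is an edge of G. For u ∈ V(G) let û = {i ∈ {1,…,n} : u ∈ V(T_i)}. Then the pure simplicial complex M on the vertex set {1,…,n} whose facets are the sets û for u ∈ V(G) is a d-dimensional, 2-neighborly member of K̄(d) (every vertex link of M is a stacked (d-1)-ball), and the map u ↦ û is a graph isomorphism from G onto the dual graph Λ(M). -/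
variable {V : Type*} [DecidableEq V]

/-- For `u ∈ V(G)`, the set `û = {i : u ∈ V(T_i)}`. -/
def hatFacet {U : Type*} [DecidableEq U] (n : ℕ) (W : Fin n → Finset U) (u : U) : Finset (Fin n) :=
  {i : Fin n | u ∈ W i}

/-- The pure simplicial complex `M` whose facets are the sets `û`, `u ∈ V(G)`. -/
def hatComplex {U : Type*} [Fintype U] [DecidableEq U] (n : ℕ) (W : Fin n → Finset U) :
    Finset (Finset (Fin n)) :=
  (Finset.univ : Finset U).image (hatFacet n W)

inductive TBuild {U : Type*} [DecidableEq U] (G : SimpleGraph U) (W : Finset U) : Finset U → Prop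
  | one (u : U) : u ∈ W → TBuild G W {u}
  | step (S : Finset U) (u v : U) : TBuild G W S → u ∈ S → v ∈ W → v ∉ S → G.Adj u v →
      TBuild G W (insert v S)

theorem TBuild.sub {U : Type*} [DecidableEq U] {G : SimpleGraph U} {W S : Finset U}
    (h : TBuild G W S) : S ⊆ W := by
  induction h with
  | one u hu => simpa using hu
  | step S u v hS hu hv hvS hadj ih => exact Finset.insert_subset hv ih

theorem TBuild.nonempty {U : Type*} [DecidableEq U] {G : SimpleGraph U} {W S : Finset U}
    (h : TBuild G W S) : S.Nonempty := by
  induction h with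
  | one u hu => simp
  | step S u v hS hu hv hvS hadj ih => simp

theorem tbuild_all {U : Type*} [DecidableEq U] {G : SimpleGraph U} {W : Finset U}
    (hc : (G.induce (W : Set U)).Connected) : TBuild G W W := by
  have key : ∀ k, k < W.card → ∃ S, TBuild G W S ∧ S.card = k + 1 := by
    intro k
    induction k with
    | zero =>
      intro hk
      obtain ⟨u, hu⟩ := Finset.card_pos.mp hk
      exact ⟨{u}, TBuild.one u hu, by simp⟩
    | succ k ih =>
      intro hk
      obtain ⟨S, hS, hSc⟩ := ih (by omega)
      obtain ⟨u, hu⟩ := hS.nonempty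
      obtain ⟨w, hw, hwS⟩ := Finset.exists_mem_notMem_of_card_lt_card (s := S) (t := W) (by omega)
      obtain ⟨p⟩ := hc.preconnected ⟨u, hS.sub hu⟩ ⟨w, hw⟩
      obtain ⟨e, -, h1, h2⟩ := p.exists_boundary_dart {x | x.1 ∈ S} hu hwS
      refine ⟨insert e.snd.1 S, TBuild.step S e.fst.1 e.snd.1 hS h1 e.snd.2 h2 e.adj, ?_⟩
      rw [Finset.card_insert_of_notMem h2, hSc]
  obtain ⟨⟨x, hx⟩⟩ := hc.nonempty
  have hpos : 0 < W.card := Finset.card_pos.mpr ⟨x, hx⟩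
  obtain ⟨S, hS, hSc⟩ := key (W.card - 1) (by omega)
  have : S = W := Finset.eq_of_subset_of_card_le hS.sub (by omega)
  rwa [this] at hS

theorem TBuild.card_le {U A : Type*} [DecidableEq U] [DecidableEq A] {G : SimpleGraph U}
    {W S : Finset U} (H : U → Finset A) (d : ℕ) (hH : ∀ u, (H u).card = d + 1)
    (hadj : ∀ u v, G.Adj u v → (H u ∩ H v).card = d)
    (h : TBuild G W S) : (S.biUnion H).card ≤ d + S.card := by
  induction h with
  | one u hu => simp [hH]
  | step S u v hS hu hv hvS ha ih =>
    rw [Finset.biUnion_insert, Finset.card_insert_of_notMem hvS]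
    have h1 := Finset.card_union_add_card_inter (H v) (S.biUnion H)
    have h2 : H u ∩ H v ⊆ H v ∩ S.biUnion H := by
      intro x hx
      simp only [Finset.mem_inter, Finset.mem_biUnion] at hx ⊢
      exact ⟨hx.2, u, hu, hx.1⟩
    have h3 := Finset.card_le_card h2
    rw [hadj u v ha] at h3
    rw [hH] at h1
    omega

theorem no_tri {U : Type*} {G : SimpleGraph U} {W : Set U}
    (hac : (G.induce W).IsAcyclic) {u v w : U} (hu : u ∈ W) (hv : v ∈ W) (hw : w ∈ W)
    (h1 : G.Adj u v) (h2 : G.Adj v w) (h3 : G.Adj w u) : False := by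
  have a1 : (G.induce W).Adj ⟨u, hu⟩ ⟨v, hv⟩ := h1
  have a2 : (G.induce W).Adj ⟨v, hv⟩ ⟨w, hw⟩ := h2
  have a3 : (G.induce W).Adj ⟨w, hw⟩ ⟨u, hu⟩ := h3
  refine hac (SimpleGraph.Walk.cons a1 (SimpleGraph.Walk.cons a2 (SimpleGraph.Walk.cons a3 .nil))) ?_
  rw [SimpleGraph.Walk.cons_isCycle_iff]
  have := h1.ne
  have := h2.ne
  have := h3.ne
  constructor
  · simp [SimpleGraph.Walk.cons_isPath_iff]
    grind
  · simp
    grind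

theorem TBuild.stacked {U A : Type*} [DecidableEq U] [DecidableEq A] {G : SimpleGraph U}
    {W S : Finset U} (H : U → Finset A) (d : ℕ) (i : A) (hH : ∀ u, (H u).card = d + 2)
    (hac : (G.induce (W : Set U)).IsAcyclic)
    (hi : ∀ u ∈ W, i ∈ H u)
    (hadj : ∀ u v, u ≠ v → ((H u ∩ H v).card = d + 1 ↔ G.Adj u v))
    (h : TBuild G W S) (hS : (S.biUnion H).card = d + 1 + S.card) :
    Set.InjOn H (S : Set U) ∧ IsStackedBall d (S.image fun u => (H u).erase i) := by
  induction h with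
  | one u hu =>
    refine ⟨by simp, ?_⟩
    rw [Finset.image_singleton]
    refine IsStackedBall.single d _ ?_
    rw [Finset.card_erase_of_mem (hi u hu), hH]; rfl
  | step S u v hB hu hv hvS ha ih =>
    rw [Finset.biUnion_insert, Finset.card_insert_of_notMem hvS] at hS
    have h1 := Finset.card_union_add_card_inter (H v) (S.biUnion H)
    have h2 : H u ∩ H v ⊆ H v ∩ S.biUnion H := by
      intro x hx
      simp only [Finset.mem_inter, Finset.mem_biUnion] at hx ⊢
      exact ⟨hx.2, u, hu, hx.1⟩
    have h3 := Finset.card_le_card h2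
    have huv : (H u ∩ H v).card = d + 1 := (hadj u v ha.ne).mpr ha
    have h4 := hB.card_le H (d + 1) hH (fun u v h => (hadj u v h.ne).mpr h)
    rw [hH] at h1
    obtain ⟨hinj, hball⟩ := ih (by omega)
    have h5 : H u ∩ H v = H v ∩ S.biUnion H := Finset.eq_of_subset_of_card_le h2 (by omega)
    have hsub : ∀ w ∈ S, H w ∩ H v ⊆ H u ∩ H v := by
      intro w hw x hx
      rw [h5]
      simp only [Finset.mem_inter, Finset.mem_biUnion] at hx ⊢
      exact ⟨hx.2, w, hw, hx.1⟩
    have hne : ∀ w ∈ S, H w ≠ H v := by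
      intro w hw he
      have := Finset.card_le_card (hsub w hw)
      rw [he, Finset.inter_self, hH] at this
      omega
    have hSW := hB.sub
    have huniq : ∀ w ∈ S, H u ∩ H v ⊆ H w → w = u := by
      intro w hw hsw
      by_contra hwu
      have hwv : w ≠ v := fun h => hvS (h ▸ hw)
      have e1 : H w ∩ H v = H u ∩ H v :=
        (hsub w hw).antisymm (Finset.subset_inter hsw Finset.inter_subset_right)
      have a1 : G.Adj w v := (hadj w v hwv).mp (by rw [e1, huv])
      have c1 : d + 1 ≤ (H w ∩ H u).card := by
        rw [← huv]
        exact Finset.card_le_card (Finset.subset_inter hsw Finset.inter_subset_left)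
      have c2 : (H w ∩ H u).card ≤ d + 2 := by
        rw [← hH w]; exact Finset.card_le_card Finset.inter_subset_left
      have c3 : (H w ∩ H u).card ≠ d + 2 := by
        intro hc
        have e2 : H w ∩ H u = H w :=
          Finset.eq_of_subset_of_card_le Finset.inter_subset_left (by rw [hc, hH])
        have e3 : H w ∩ H u = H u :=
          Finset.eq_of_subset_of_card_le Finset.inter_subset_right (by rw [hc, hH])
        exact hwu (hinj hw hu (e2.symm.trans e3))
      have a2 : G.Adj w u := (hadj w u hwu).mp (by omega)
      exact no_tri hac (hSW hu) hv (hSW hw) ha a1.symm a2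
    constructor
    · intro a ha' b hb hab
      simp only [Finset.coe_insert, Set.mem_insert_iff, Finset.mem_coe] at ha' hb
      rcases ha' with rfl | ha' <;> rcases hb with rfl | hb
      · rfl
      · exact absurd hab.symm (hne b hb)
      · exact absurd hab (hne a ha')
      · exact hinj ha' hb hab
    · rw [Finset.image_insert]
      have hiv := hi v hv
      have hiu := hi u (hSW hu)
      refine IsStackedBall.glue d _ _ ((H u ∩ H v).erase i) hball ?_ ?_ ?_ ?_ ?_ ?_
      · rw [Finset.card_erase_of_mem hiv, hH]; rfl
      · intro hm
        obtain ⟨w, hw, he⟩ := Finset.mem_image.mp hm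
        apply hne w hw
        rw [← Finset.insert_erase (hi w (hSW hw)), ← Finset.insert_erase hiv, he]
      · exact Finset.erase_subset_erase _ Finset.inter_subset_right
      · rw [Finset.card_erase_of_mem (Finset.mem_inter.mpr ⟨hiu, hiv⟩), huv]; rfl
      · refine ⟨(H u).erase i, ⟨Finset.mem_image_of_mem _ hu,
          Finset.erase_subset_erase _ Finset.inter_subset_left⟩, ?_⟩
        rintro ρ ⟨hρ, hsρ⟩
        obtain ⟨w, hw, rfl⟩ := Finset.mem_image.mp hρ
        have : w = u := by
          apply huniq w hw
          intro x hx
          by_cases hxi : x = i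
          · rw [hxi]; exact hi w (hSW hw)
          · exact Finset.mem_of_mem_erase (hsρ (Finset.mem_erase.mpr ⟨hxi, hx⟩))
        rw [this]
      · intro ρ hρ x hx
        obtain ⟨w, hw, rfl⟩ := Finset.mem_image.mp hρ
        simp only [Finset.mem_inter, Finset.mem_erase] at hx
        exact Finset.mem_erase.mpr ⟨hx.1.1, hsub w hw (Finset.mem_inter.mpr ⟨hx.1.2, hx.2.2⟩)⟩

/-- Let `G` be a graph and `T_1, …, T_n` (given by their vertex sets
`W 1, …, W n`, inducing trees in `G`) a family of induced subtrees of `G`, each on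
exactly `n - d` vertices, such that (0) any two members intersect, (i) each vertex of
`G` lies in exactly `d + 1` members, and (ii) two distinct vertices `u, v` lie together
in exactly `d` members iff `uv` is an edge of `G`.  Then the pure simplicial complex `M`
on `{1, …, n}` with facets `û = {i : u ∈ T_i}` is `d`-dimensional (each facet has `d+1`
vertices), 2-neighborly, all its vertex links are stacked `(d-1)`-balls (it is a
neighborly member of `K̄(d)`), and `u ↦ û` is a graph isomorphism of `G` onto the dual
graph `Λ(M)`. -/
theorem stmt7 {U : Type*} [Fintype U] [DecidableEq U] (G : SimpleGraph U)
    (n d : ℕ) (hd : 1 ≤ d) (W : Fin n → Finset U)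
    (htree : ∀ i : Fin n, (G.induce (W i : Set U)).IsTree)
    (hcard : ∀ i : Fin n, (W i).card = n - d)
    (hmeet : ∀ i j : Fin n, ∃ u : U, u ∈ W i ∧ u ∈ W j)
    (hdeg : ∀ u : U, ({i : Fin n | u ∈ W i} : Finset (Fin n)).card = d + 1)
    (hedge : ∀ u v : U, u ≠ v →
      ((({i : Fin n | u ∈ W i ∧ v ∈ W i} : Finset (Fin n)).card = d) ↔ G.Adj u v)) :
    (∀ σ ∈ hatComplex n W, σ.card = d + 1) ∧
      (∀ i j : Fin n, ∃ σ ∈ hatComplex n W, i ∈ σ ∧ j ∈ σ) ∧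
      (∀ i ∈ vertexSet (hatComplex n W),
        IsStackedBall (d - 1) (linkFacets (hatComplex n W) i)) ∧
      ∃ e : G ≃g dualGraph d (hatComplex n W),
        ∀ u : U, (e u : Finset (Fin n)) = hatFacet n W u := by
  obtain ⟨e, rfl⟩ : ∃ e, d = e + 1 := ⟨d - 1, by omega⟩
  have hH : ∀ u, (hatFacet n W u).card = e + 2 := hdeg
  have hmem : ∀ u i, i ∈ hatFacet n W u ↔ u ∈ W i := by
    intro u i; simp [hatFacet]
  have hint : ∀ u v, u ≠ v →
      ((hatFacet n W u ∩ hatFacet n W v).card = e + 1 ↔ G.Adj u v) := by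
    intro u v huv
    rw [← hedge u v huv]
    have : hatFacet n W u ∩ hatFacet n W v =
        ({i : Fin n | u ∈ W i ∧ v ∈ W i} : Finset (Fin n)) := by
      ext x; simp [hatFacet]
    rw [this]
  have hmain : ∀ i, Set.InjOn (hatFacet n W) (W i : Set U) ∧
      IsStackedBall e ((W i).image fun u => (hatFacet n W u).erase i) := by
    intro i
    refine TBuild.stacked (G := G) (hatFacet n W) e i hH (htree i).isAcyclic
      (fun u hu => (hmem u i).mpr hu) hint (tbuild_all (htree i).connected) ?_
    have hu : (W i).biUnion (hatFacet n W) = Finset.univ := by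
      ext j
      obtain ⟨u, h1, h2⟩ := hmeet i j
      simp only [Finset.mem_biUnion, Finset.mem_univ, iff_true]
      exact ⟨u, h1, (hmem u j).mpr h2⟩
    obtain ⟨u, h1, -⟩ := hmeet i i
    have hpos : 0 < (W i).card := Finset.card_pos.mpr ⟨u, h1⟩
    have := hcard i
    rw [hu, Finset.card_univ, Fintype.card_fin]
    omega
  have hinj : Function.Injective (hatFacet n W) := by
    intro u v huv
    have hne : (hatFacet n W u).Nonempty := by
      rw [← Finset.card_pos, hH]; omega
    obtain ⟨i, hi⟩ := hne
    exact (hmain i).1 ((hmem u i).mp hi) ((hmem v i).mp (huv ▸ hi)) huv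
  refine ⟨?_, ?_, ?_, ?_⟩
  · intro σ hσ
    obtain ⟨u, -, rfl⟩ := Finset.mem_image.mp hσ
    exact hH u
  · intro i j
    obtain ⟨u, h1, h2⟩ := hmeet i j
    exact ⟨hatFacet n W u, Finset.mem_image_of_mem _ (Finset.mem_univ u),
      (hmem u i).mpr h1, (hmem u j).mpr h2⟩
  · intro i _
    have : linkFacets (hatComplex n W) i =
        (W i).image fun u => (hatFacet n W u).erase i := by
      ext σ
      simp only [linkFacets, hatComplex, Finset.mem_image, Finset.mem_filter, Finset.mem_univ,
        true_and]
      constructor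
      · rintro ⟨_, ⟨⟨u, rfl⟩, hu⟩, rfl⟩
        exact ⟨u, (hmem u i).mp hu, rfl⟩
      · rintro ⟨u, hu, rfl⟩
        exact ⟨_, ⟨⟨u, rfl⟩, (hmem u i).mpr hu⟩, rfl⟩
    rw [this]
    exact (hmain i).2
  · let f : U → {σ // σ ∈ hatComplex n W} := fun u =>
      ⟨hatFacet n W u, Finset.mem_image_of_mem _ (Finset.mem_univ u)⟩
    have hf : Function.Bijective f := by
      constructor
      · intro u v h
        exact hinj (congrArg Subtype.val h)
      · rintro ⟨σ, hσ⟩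
        obtain ⟨u, -, rfl⟩ := Finset.mem_image.mp hσ
        exact ⟨u, rfl⟩
    refine ⟨⟨Equiv.ofBijective f hf, ?_⟩, fun u => rfl⟩
    intro u v
    change (f u ≠ f v ∧ (hatFacet n W u ∩ hatFacet n W v).card = e + 1) ↔ G.Adj u v
    constructor
    · rintro ⟨h1, h2⟩
      exact (hint u v (fun h => h1 (h ▸ rfl))).mp h2
    · intro h
      exact ⟨fun h' => h.ne (hf.1 h'), (hint u v h.ne).mpr h⟩
end

section
/- Let n and c be integers with n ≥ 15 and n(n − 11) = −15c. Then c is even and negative, and (−c/2) divides n if and only if n ∈ {21, 26, 41}. -/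
/-- If `n` and `c` are integers with `n ≥ 15` and `n (n - 11) = -15 c`,
then `c` is even and negative, and `-c/2` divides `n` if and only if
`n ∈ {21, 26, 41}`. -/
theorem stmt9 (n c : ℤ) (hn : 15 ≤ n) (h : n * (n - 11) = -15 * c) :
    Even c ∧ c < 0 ∧ ((-c) / 2 ∣ n ↔ n = 21 ∨ n = 26 ∨ n = 41) := by
  have hneg : c < 0 := by nlinarith
  have hev : Even c := by
    have h1 : Even (n * (n - 11)) := by
      rcases Int.even_or_odd n with hh | hh
      · exact hh.mul_right _
      · exact (hh.sub_odd (by decide)).mul_left _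
    rw [h] at h1
    rcases Int.even_mul.mp h1 with h2 | h2
    · exact absurd h2 (by decide)
    · exact h2
  refine ⟨hev, hneg, ?_⟩
  obtain ⟨m, hm⟩ := hev
  obtain ⟨d, rfl⟩ : ∃ d, m = -d := ⟨-m, by ring⟩
  have hd : (-c) / 2 = d := by omega
  rw [hd]
  have hn2 : n * (n - 11) = 30 * d := by rw [h, hm]; ring
  have hd0 : d ≠ 0 := by omega
  constructor
  · rintro ⟨k, hk⟩
    have e : (n - 11) * k = 30 := by
      apply mul_left_cancel₀ hd0
      calc d * ((n - 11) * k) = (d * k) * (n - 11) := by ring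
        _ = n * (n - 11) := by rw [← hk]
        _ = d * 30 := by rw [hn2]; ring
    have hle : n - 11 ≤ 30 := Int.le_of_dvd (by norm_num) ⟨k, e.symm⟩
    have hn3 : n ≤ 41 := by omega
    clear h hk
    interval_cases n <;> omega
  · rintro (rfl | rfl | rfl)
    · exact ⟨3, by omega⟩
    · exact ⟨2, by omega⟩
    · exact ⟨1, by omega⟩
end

section
/- Let A⁵₂₁ be the pure 5-dimensional simplicial complex on the 21-element vertex set V₂₁ = {a_i, b_i, c_i : i ∈ Z₇} whose 56 facets are the images under the Z₇-action (j·a_k = a_{j+k}, j·b_k = b_{j+k}, j·c_k = c_{j+k}, indices mod 7) of the eight facets a₀a₁a₂b₀b₁c₀, a₁a₂b₀b₁b₂c₀, a₁a₂a₃b₀b₁b₂, a₀a₁b₀b₁c₀c₃, a₀a₁b₀b₃c₀c₃, a₀b₀b₃c₀c₃c₄, a₀a₃b₃c₀c₃c₄, a₃b₃c₀c₃c₄c₆. Then A⁵₂₁ is 2-neighborly and every vertex link of A⁵₂₁ is a stacked 4-ball (i.e., A⁵₂₁ is a neighborly member of K̄(5)). -/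
variable {V : Type*} [DecidableEq V]

/-- The vertices `a_i`, `b_i`, `c_i`, `i ∈ Z₇`, of `V₂₁`. -/
def a (i : ZMod 7) : Fin 3 × ZMod 7 := (0, i)
def b (i : ZMod 7) : Fin 3 × ZMod 7 := (1, i)
def c (i : ZMod 7) : Fin 3 × ZMod 7 := (2, i)

/-- The `Z₇`-action `j ⬝ a_k = a_{j+k}`, `j ⬝ b_k = b_{j+k}`, `j ⬝ c_k = c_{j+k}`. -/
def shift7 (j : ZMod 7) (σ : Finset (Fin 3 × ZMod 7)) : Finset (Fin 3 × ZMod 7) :=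
  σ.image fun p => (p.1, p.2 + j)

/-- The eight basic facets of `A⁵₂₁`. -/
def baseA21 : Finset (Finset (Fin 3 × ZMod 7)) :=
  { {a 0, a 1, a 2, b 0, b 1, c 0}, {a 1, a 2, b 0, b 1, b 2, c 0},
    {a 1, a 2, a 3, b 0, b 1, b 2}, {a 0, a 1, b 0, b 1, c 0, c 3},
    {a 0, a 1, b 0, b 3, c 0, c 3}, {a 0, b 0, b 3, c 0, c 3, c 4},
    {a 0, a 3, b 3, c 0, c 3, c 4}, {a 3, b 3, c 0, c 3, c 4, c 6} }

/-- The facet set of `A⁵₂₁` : all `Z₇`-images of the eight basic facets. -/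
def A21 : Finset (Finset (Fin 3 × ZMod 7)) :=
  (Finset.univ : Finset (ZMod 7)).biUnion fun j => baseA21.image (shift7 j)

/-! Vertex sets are encoded as 21-bit masks. -/

def encV (v : Fin 3 × ZMod 7) : ℕ := 7 * v.1.val + v.2.val

def decS (m : ℕ) : Finset (Fin 3 × ZMod 7) := Finset.univ.filter fun v => m.testBit (encV v) = true

def pcN (m : ℕ) : ℕ := ((List.range 21).filter fun i => m.testBit i).length

def rotB (j w : ℕ) : ℕ := (w * 2 ^ j) % 128 + (w * 2 ^ j) / 128

def rotN (j m : ℕ) : ℕ :=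
  rotB j (m % 128) + 128 * rotB j (m / 128 % 128) + 16384 * rotB j (m / 16384)

def bmA : List ℕ := [16775, 17286, 910, 147843, 148611, 410753, 410633, 1459208]

def orda : List (ℕ × ℕ) :=
  [(311440, 311424), (442496, 409728), (410632, 410624), (410752, 148608),
   (1122880, 1122368), (1122496, 1056960), (14432, 12384), (536672, 536640),
   (536768, 12480), (148610, 147586), (147842, 16770), (12482, 8386),
   (1056962, 1056898), (1057154, 8578), (16774, 390), (8582, 0)]

def ordb : List (ℕ × ℕ) :=
  [(280624, 280592), (313360, 311312), (782, 774), (17158, 16646),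
   (311313, 311297), (442369, 409601), (410625, 148481), (1122369, 1056833),
   (536641, 12353), (148483, 147459), (147715, 16643), (12355, 8259),
   (1056835, 1056771), (1057027, 8451), (16647, 263), (8455, 0)]

def ordc : List (ℕ × ℕ) :=
  [(1253440, 1187904), (821264, 296976), (268336, 264240), (264368, 264336),
   (297104, 295056), (1187912, 1187848), (1188872, 1180680), (1442824, 394248),
   (902, 390), (295057, 295041), (426113, 393345), (394249, 394241),
   (394369, 132225), (132227, 131203), (131459, 387), (391, 0)]

def mA : List ℕ := (List.range 7).flatMap fun j => bmA.map (rotN j)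

def lkN (e : ℕ) : List ℕ := (mA.filter fun m => m.testBit e).map fun m => m ^^^ 2 ^ e

theorem mem_decS (m : ℕ) (v) : v ∈ decS m ↔ m.testBit (encV v) = true := by simp [decS]

theorem val_lt7 (z : ZMod 7) : z.val < 7 := ZMod.val_lt z

theorem encV_lt (v) : encV v < 21 := by
  have h1 := v.1.isLt
  have h2 := val_lt7 v.2
  unfold encV
  omega

theorem encV_inj : Function.Injective encV := by
  intro v w h
  have h1 := val_lt7 v.2
  have h2 := val_lt7 w.2
  unfold encV at h
  refine Prod.ext (Fin.ext (by omega)) (ZMod.val_injective 7 (by omega))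

theorem encV_surj (i : ℕ) (hi : i < 21) : ∃ v, encV v = i := by
  refine ⟨(⟨i / 7, by omega⟩, ((i % 7 : ℕ) : ZMod 7)), ?_⟩
  unfold encV
  rw [ZMod.val_natCast]
  simp only
  omega

theorem card_decS (m : ℕ) : (decS m).card = pcN m := by
  have h : (decS m).image encV = (Finset.range 21).filter fun i => m.testBit i = true := by
    ext i
    rw [Finset.mem_image, Finset.mem_filter, Finset.mem_range]
    constructor
    · rintro ⟨v, hv, rfl⟩
      exact ⟨encV_lt v, (mem_decS m v).1 hv⟩
    · rintro ⟨hi, ht⟩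
      obtain ⟨v, rfl⟩ := encV_surj i hi
      exact ⟨v, (mem_decS m v).2 ht, rfl⟩
  rw [← Finset.card_image_of_injective _ encV_inj, h]
  unfold pcN
  rw [← List.toFinset_card_of_nodup (List.Nodup.filter _ List.nodup_range)]
  congr 1
  ext i
  simp

theorem decS_inter (m n : ℕ) : decS m ∩ decS n = decS (m &&& n) := by
  ext v
  simp [mem_decS, Nat.testBit_and]

theorem decS_subset {m n : ℕ} (h : m &&& n = m) : decS m ⊆ decS n := by
  intro v hv
  rw [mem_decS] at *
  rw [← h, Nat.testBit_and, Bool.and_eq_true] at hv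
  exact hv.2

theorem decS_subset_iff {m n : ℕ} (hm : m < 2 ^ 21) : decS m ⊆ decS n ↔ m &&& n = m := by
  refine ⟨fun h => ?_, decS_subset⟩
  apply Nat.eq_of_testBit_eq
  intro i
  rw [Nat.testBit_and]
  by_cases hi : i < 21
  · obtain ⟨v, rfl⟩ := encV_surj i hi
    have := @h v
    rw [mem_decS, mem_decS] at this
    cases h1 : m.testBit (encV v) <;> simp_all
  · have : m.testBit i = false :=
      Nat.testBit_lt_two_pow (lt_of_lt_of_le hm (Nat.pow_le_pow_right (by norm_num) (by omega)))
    simp [this]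

theorem decS_erase (m : ℕ) (x) (hx : m.testBit (encV x) = true) :
    (decS m).erase x = decS (m ^^^ 2 ^ encV x) := by
  ext v
  rw [Finset.mem_erase, mem_decS, mem_decS, Nat.testBit_xor, Nat.testBit_two_pow]
  by_cases h : v = x
  · subst h
    simp [hx]
  · have h2 : encV x ≠ encV v := fun e => h (encV_inj e.symm)
    simp [h, h2]

theorem val_sub7 : ∀ v j : ZMod 7, (v - j).val = (v.val + 7 - j.val) % 7 := by decide

theorem rot_check : ((List.range 7).all fun j => bmA.all fun m => (List.range 3).all fun t =>
    (List.range 7).all fun k =>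
      (rotN j m).testBit (7 * t + k) == m.testBit (7 * t + (k + 7 - j) % 7)) = true := by
  decide +kernel

theorem shift_decS (j : ZMod 7) (m : ℕ) (hm : m ∈ bmA) :
    shift7 j (decS m) = decS (rotN j.val m) := by
  have hc := rot_check
  simp only [List.all_eq_true, List.mem_range, beq_iff_eq] at hc
  ext v
  have h1 := hc j.val (val_lt7 j) m hm v.1.val v.1.isLt v.2.val (val_lt7 v.2)
  rw [mem_decS]
  unfold encV
  rw [h1, ← val_sub7]
  unfold shift7
  rw [Finset.mem_image]
  constructor
  · rintro ⟨p, hp, rfl⟩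
    rw [mem_decS] at hp
    simpa [encV] using hp
  · intro h
    refine ⟨(v.1, v.2 - j), ?_, ?_⟩
    · rw [mem_decS]
      exact h
    · simp

theorem base_eq : baseA21 = (bmA.map decS).toFinset := by
  unfold baseA21 bmA
  simp only [List.map_cons, List.map_nil, List.toFinset_cons, List.toFinset_nil]
  refine congrArg₂ insert (by decide +kernel) ?_
  refine congrArg₂ insert (by decide +kernel) ?_
  refine congrArg₂ insert (by decide +kernel) ?_
  refine congrArg₂ insert (by decide +kernel) ?_
  refine congrArg₂ insert (by decide +kernel) ?_
  refine congrArg₂ insert (by decide +kernel) ?_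
  refine congrArg₂ insert (by decide +kernel) ?_
  rw [insert_empty_eq]
  exact congrArg singleton (by decide +kernel)

theorem mem_A21 (σ) : σ ∈ A21 ↔ ∃ m ∈ mA, decS m = σ := by
  unfold A21 mA
  simp only [base_eq, Finset.mem_biUnion, Finset.mem_univ, true_and, Finset.mem_image,
    List.mem_toFinset, List.mem_map, List.mem_flatMap, List.mem_range]
  constructor
  · rintro ⟨j, _, ⟨m, hm, rfl⟩, rfl⟩
    exact ⟨_, ⟨j.val, val_lt7 j, m, hm, rfl⟩, (shift_decS j m hm).symm⟩
  · rintro ⟨_, ⟨j, hj, m, hm, rfl⟩, rfl⟩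
    refine ⟨(j : ZMod 7), _, ⟨m, hm, rfl⟩, ?_⟩
    rw [shift_decS _ m hm, ZMod.val_natCast, Nat.mod_eq_of_lt hj]

theorem mem_link (x σ) : σ ∈ linkFacets A21 x ↔ ∃ m ∈ lkN (encV x), decS m = σ := by
  unfold linkFacets lkN
  simp only [Finset.mem_image, Finset.mem_filter, List.mem_map, List.mem_filter]
  constructor
  · rintro ⟨s, ⟨hs, hx⟩, rfl⟩
    obtain ⟨m, hm, rfl⟩ := (mem_A21 s).1 hs
    rw [mem_decS] at hx
    exact ⟨_, ⟨m, ⟨hm, hx⟩, rfl⟩, (decS_erase m x hx).symm⟩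
  · rintro ⟨_, ⟨m, ⟨hm, hx⟩, rfl⟩, rfl⟩
    exact ⟨decS m, ⟨(mem_A21 _).2 ⟨m, hm, rfl⟩, (mem_decS m x).2 hx⟩, decS_erase m x hx⟩

/-- Checks that the list, read from the end, describes a stacked 4-ball:
each entry is a new facet together with the face along which it is glued. -/
def good : List (ℕ × ℕ) → Bool
  | [] => false
  | [p] => pcN p.1 == 5
  | p :: q :: l => good (q :: l) && pcN p.1 == 5 && p.2 &&& p.1 == p.2 && pcN p.2 == 4 &&
      decide (p.2 < 2 ^ 21) &&
      ((q :: l).any fun r => p.2 &&& r.1 == p.2 &&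
        (q :: l).all fun s => !(p.2 &&& s.1 == p.2) || s.1 == r.1) &&
      ((q :: l).all fun r => (r.1 &&& p.1) &&& p.2 == (r.1 &&& p.1))

theorem good_sound : ∀ l, good l = true →
    IsStackedBall 4 (l.map fun p => decS p.1).toFinset
  | [], h => by simp [good] at h
  | [p], h => by
    simp only [good, beq_iff_eq] at h
    have := IsStackedBall.single 4 (decS p.1) ((card_decS _).trans h)
    simpa using this
  | p :: q :: l, h => by
    rw [good] at h
    simp only [Bool.and_eq_true, decide_eq_true_eq, beq_iff_eq, List.any_eq_true,
      List.all_eq_true, Bool.or_eq_true, Bool.not_eq_true', beq_eq_false_iff_ne] at h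
    obtain ⟨⟨⟨⟨⟨⟨h0, h1⟩, h3⟩, h4⟩, hlt⟩, ⟨r, hr, hpr, hu⟩⟩, h6⟩ := h
    have ih := good_sound (q :: l) h0
    rw [List.map_cons, List.toFinset_cons]
    have key : ∀ ρ, ρ ∈ ((q :: l).map fun p => decS p.1).toFinset ↔
        ∃ s ∈ q :: l, decS s.1 = ρ := by
      intro ρ
      rw [List.mem_toFinset, List.mem_map]
    have hint : ∀ ρ ∈ ((q :: l).map fun p => decS p.1).toFinset,
        ρ ∩ decS p.1 ⊆ decS p.2 := by
      intro ρ hρ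
      obtain ⟨s, hs, rfl⟩ := (key _).1 hρ
      rw [decS_inter]
      exact decS_subset (h6 s hs)
    have c1 := (card_decS p.1).trans h1
    have c2 := (card_decS p.2).trans h4
    refine IsStackedBall.glue 4 _ (decS p.1) (decS p.2) ih c1 ?_ (decS_subset h3) c2 ?_ hint
    · intro hmem
      have := Finset.card_le_card (hint _ hmem)
      rw [Finset.inter_self] at this
      omega
    · refine ⟨decS r.1, ⟨(key _).2 ⟨r, hr, rfl⟩, decS_subset hpr⟩, ?_⟩
      rintro ρ ⟨hρ, hsub⟩
      obtain ⟨s, hs, rfl⟩ := (key _).1 hρ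
      rcases hu s hs with h | h
      · exact absurd ((decS_subset_iff hlt).1 hsub) h
      · rw [h]

def ordx (t j : ℕ) : List (ℕ × ℕ) :=
  (bif t == 0 then orda else bif t == 1 then ordb else ordc).map
    fun p => (rotN j p.1, rotN j p.2)

theorem ordx_check : ((List.range 3).all fun t => (List.range 7).all fun j =>
    good (ordx t j) && ((lkN (7 * t + j)).all fun m => (ordx t j).any fun p => p.1 == m) &&
      (ordx t j).all fun p => (lkN (7 * t + j)).any fun m => m == p.1) = true := by
  decide +kernel

theorem card_check : (mA.all fun m => pcN m == 6) = true := by decide +kernel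

theorem nbr_check : ((List.range 21).all fun i => (List.range 21).all fun k =>
    mA.any fun m => m.testBit i && m.testBit k) = true := by decide +kernel

theorem nbr_A21 (x y : Fin 3 × ZMod 7) : ∃ σ ∈ A21, x ∈ σ ∧ y ∈ σ := by
  have hc := nbr_check
  simp only [List.all_eq_true, List.any_eq_true, List.mem_range, Bool.and_eq_true] at hc
  obtain ⟨m, hm, h1, h2⟩ := hc _ (encV_lt x) _ (encV_lt y)
  exact ⟨decS m, (mem_A21 _).2 ⟨m, hm, rfl⟩, (mem_decS _ _).2 h1, (mem_decS _ _).2 h2⟩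

theorem link_A21 (x : Fin 3 × ZMod 7) : IsStackedBall 4 (linkFacets A21 x) := by
  have hc := ordx_check
  simp only [List.all_eq_true, List.any_eq_true, List.mem_range, Bool.and_eq_true,
    beq_iff_eq] at hc
  obtain ⟨⟨hg, h1⟩, h2⟩ := hc x.1.val x.1.isLt x.2.val (val_lt7 x.2)
  have he : linkFacets A21 x = ((ordx x.1.val x.2.val).map fun p => decS p.1).toFinset := by
    ext σ
    rw [mem_link, List.mem_toFinset, List.mem_map]
    constructor
    · rintro ⟨m, hm, rfl⟩
      obtain ⟨p, hp, e⟩ := h1 m hm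
      exact ⟨p, hp, by rw [e]⟩
    · rintro ⟨p, hp, rfl⟩
      obtain ⟨m, hm, e⟩ := h2 p hp
      exact ⟨m, hm, by rw [e]⟩
  rw [he]
  exact good_sound _ hg

/-- `A⁵₂₁` is a pure 5-dimensional complex on the 21-element vertex
set `V₂₁` which is 2-neighborly and all of whose vertex links are stacked 4-balls,
i.e. it is a neighborly member of `K̄(5)`. -/
theorem stmt10 :
    (∀ σ ∈ A21, σ.card = 6) ∧
      vertexSet A21 = (Finset.univ : Finset (Fin 3 × ZMod 7)) ∧
      (∀ x y : Fin 3 × ZMod 7, ∃ σ ∈ A21, x ∈ σ ∧ y ∈ σ) ∧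
      (∀ x : Fin 3 × ZMod 7, IsStackedBall 4 (linkFacets A21 x)) := by
  refine ⟨?_, ?_, nbr_A21, link_A21⟩
  · intro σ hσ
    obtain ⟨m, hm, rfl⟩ := (mem_A21 σ).1 hσ
    have hc := card_check
    simp only [List.all_eq_true, beq_iff_eq] at hc
    rw [card_decS, hc m hm]
  · ext x
    obtain ⟨σ, hσ, hx, _⟩ := nbr_A21 x x
    simp only [vertexSet, Finset.mem_biUnion, Finset.mem_univ, iff_true]
    exact ⟨σ, hσ, hx⟩
end

section
/- Let B⁵₂₁ be the pure 5-dimensional simplicial complex on the 21-element vertex set V₂₁ = {a_i, b_i, c_i : i ∈ Z₇} whose 56 facets are the images under the Z₇-action (j·a_k = a_{j+k}, j·b_k = b_{j+k}, j·c_k = c_{j+k}, indices mod 7) of the eight facets a₀a₁a₂b₀b₁c₀, a₀a₁a₂b₁b₂c₀, a₀a₁a₂a₃b₁b₂, a₀a₁b₀b₁c₀c₃, a₀b₀b₁b₃c₀c₃, a₀b₀b₃c₀c₃c₄, a₃b₀b₃c₀c₃c₄, a₃b₃c₀c₃c₄c₆. Then B⁵₂₁ is 2-neighborly and every vertex link of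 B⁵₂₁ is a stacked 4-ball (i.e., B⁵₂₁ is a neighborly member of K̄(5)). -/
variable {V : Type*} [DecidableEq V]

/-- The eight basic facets of `B⁵₂₁`. -/
def baseB21 : Finset (Finset (Fin 3 × ZMod 7)) :=
  { {a 0, a 1, a 2, b 0, b 1, c 0}, {a 0, a 1, a 2, b 1, b 2, c 0},
    {a 0, a 1, a 2, a 3, b 1, b 2}, {a 0, a 1, b 0, b 1, c 0, c 3},
    {a 0, b 0, b 1, b 3, c 0, c 3}, {a 0, b 0, b 3, c 0, c 3, c 4},
    {a 3, b 0, b 3, c 0, c 3, c 4}, {a 3, b 3, c 0, c 3, c 4, c 6} }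

/-- The facet set of `B⁵₂₁` : all `Z₇`-images of the eight basic facets. -/
def B21 : Finset (Finset (Fin 3 × ZMod 7)) :=
  (Finset.univ : Finset (ZMod 7)).biUnion fun j => baseB21.image (shift7 j)

def code21 (p : Fin 3 × ZMod 7) : ℕ := 7 * p.1.val + p.2.val

def dec21 (m : ℕ) : Finset (Fin 3 × ZMod 7) :=
  Finset.univ.filter fun p => m.testBit (code21 p) = true

theorem mem_dec21 (m : ℕ) (p : Fin 3 × ZMod 7) : p ∈ dec21 m ↔ m.testBit (code21 p) = true := by
  simp [dec21]

theorem code21_inj : ∀ p q : Fin 3 × ZMod 7, code21 p = code21 q → p = q := by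
  decide +kernel

theorem code21_surj : ∀ i : Fin 21, ∃ p : Fin 3 × ZMod 7, code21 p = i.val := by
  decide +kernel

theorem dec21_and (m n : ℕ) : dec21 (m &&& n) = dec21 m ∩ dec21 n := by
  ext p; simp [mem_dec21]

theorem dec21_sub {m n : ℕ} (hm : m < 2 ^ 21) (h : dec21 m ⊆ dec21 n) : m &&& n = m := by
  apply Nat.eq_of_testBit_eq
  intro i
  rw [Nat.testBit_and]
  by_cases hi : i < 21
  · obtain ⟨p, hp⟩ := code21_surj ⟨i, hi⟩
    have hp' : code21 p = i := hp
    have := @h p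
    rw [mem_dec21, mem_dec21, hp'] at this
    cases h1 : m.testBit i
    · simp
    · simp [this h1]
  · have : m.testBit i = false :=
      Nat.testBit_lt_two_pow (lt_of_lt_of_le hm (Nat.pow_le_pow_right (by norm_num) (by omega)))
    simp [this]

def pc21 (m : ℕ) : ℕ := (List.range 21).countP fun i => m.testBit i

theorem card_dec21 (m : ℕ) : (dec21 m).card = pc21 m := by
  have h1 : (dec21 m).image code21 = (Finset.range 21).filter fun i => m.testBit i = true := by
    ext i
    simp only [Finset.mem_image, mem_dec21, Finset.mem_filter, Finset.mem_range]
    constructor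
    · rintro ⟨p, hp, rfl⟩
      refine ⟨?_, hp⟩
      have h1 := p.1.isLt
      have h2 : p.2.val < 7 := ZMod.val_lt p.2
      unfold code21
      omega
    · rintro ⟨hi, h⟩
      obtain ⟨p, hp⟩ := code21_surj ⟨i, hi⟩
      have hp' : code21 p = i := hp
      exact ⟨p, by rw [hp']; exact h, hp'⟩
  rw [← Finset.card_image_of_injective (dec21 m) (fun p q h => code21_inj p q h), h1, pc21,
    List.countP_eq_length_filter]
  have h2 : (fun i => m.testBit i) = fun i => decide (m.testBit i = true) := by
    funext i; simp
  rw [h2]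
  rfl

def chk21 : List ℕ → Bool
  | [] => false
  | [s] => pc21 s == 5
  | s :: r :: rest => pc21 s == 5 && chk21 (r :: rest) &&
      (r :: rest).any fun u => pc21 (u &&& s) == 4 && (r :: rest).all fun q =>
        Nat.beq (q &&& s &&& (u &&& s)) (q &&& s) &&
          (Nat.beq q u || !(Nat.beq (u &&& s &&& q) (u &&& s)))

theorem chk21_stacked : ∀ l : List ℕ, (∀ m ∈ l, m < 2 ^ 21) → chk21 l = true →
    IsStackedBall 4 (l.map dec21).toFinset
  | [], _, h => by simp [chk21] at h
  | [s], _, h => by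
    have h' : pc21 s = 5 := by simpa [chk21] using h
    simpa using IsStackedBall.single 4 (dec21 s) (by rw [card_dec21, h'])
  | s :: r :: rest, hl, h => by
    rw [chk21] at h
    simp only [Bool.and_eq_true, beq_iff_eq] at h
    obtain ⟨⟨h1, h2⟩, h3⟩ := h
    have ih := chk21_stacked (r :: rest) (fun m hm => hl m (List.mem_cons_of_mem _ hm)) h2
    generalize r :: rest = L at *
    rw [List.any_eq_true] at h3
    obtain ⟨u, hu, h3⟩ := h3
    simp only [Bool.and_eq_true, beq_iff_eq, List.all_eq_true, Bool.or_eq_true,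
      Bool.not_eq_true'] at h3
    obtain ⟨h3, h4⟩ := h3
    have hsub : ∀ q ∈ L, dec21 q ∩ dec21 s ⊆ dec21 (u &&& s) := by
      intro q hq
      have := Nat.eq_of_beq_eq_true (h4 q hq).1
      rw [← dec21_and, ← this, dec21_and]
      exact Finset.inter_subset_right
    rw [List.map_cons, List.toFinset_cons]
    refine IsStackedBall.glue 4 _ (dec21 s) (dec21 (u &&& s)) ih (by rw [card_dec21, h1]) ?_
      (by rw [dec21_and]; exact Finset.inter_subset_right) (by rw [card_dec21, h3])
      ⟨dec21 u, ⟨?_, by rw [dec21_and]; exact Finset.inter_subset_left⟩, ?_⟩ ?_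
    · simp only [List.mem_toFinset, List.mem_map]
      rintro ⟨q, hq, hqs⟩
      have := Finset.card_le_card (hsub q hq)
      rw [hqs, Finset.inter_self, card_dec21, card_dec21, h1, h3] at this
      omega
    · simp only [List.mem_toFinset, List.mem_map]
      exact ⟨u, hu, rfl⟩
    · rintro ρ ⟨hρ, hs⟩
      simp only [List.mem_toFinset, List.mem_map] at hρ
      obtain ⟨q, hq, rfl⟩ := hρ
      have hlt : u &&& s < 2 ^ 21 :=
        lt_of_le_of_lt Nat.and_le_right (hl s List.mem_cons_self)
      have h5 := dec21_sub hlt hs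
      rcases (h4 q hq).2 with h6 | h6
      · rw [Nat.eq_of_beq_eq_true h6]
      · have h7 : Nat.beq (u &&& s &&& q) (u &&& s) = true := by rw [h5]; exact Nat.beq_refl _
        rw [h7] at h6
        cases h6
    · intro ρ hρ
      simp only [List.mem_toFinset, List.mem_map] at hρ
      obtain ⟨q, hq, rfl⟩ := hρ
      exact hsub q hq

def rb21 (j x : ℕ) : ℕ := ((x <<< j) ||| (x >>> (7 - j))) &&& 127

def rot21 (j m : ℕ) : ℕ :=
  rb21 j (m % 128) + 128 * rb21 j (m / 128 % 128) + 16384 * rb21 j (m / 16384)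

def baseM21 : List ℕ := [16775, 17159, 783, 147843, 148865, 410753, 410760, 1459208]

def linkM21 : Fin 3 → List ℕ
  | 0 => [313472, 442496, 410752, 148864, 1122496, 12400, 536672, 532704, 147842, 8418, 1056962, 1049026, 454, 16774, 17158, 782]
  | 1 => [1122880, 284688, 313360, 410632, 313345, 442369, 410625, 148737, 1122369, 532577, 147715, 8291, 1056835, 1048899, 16647, 327]
  | 2 => [1253440, 1188928, 821264, 268336, 268432, 297104, 1188872, 1442824, 394376, 297089, 426113, 394369, 132481, 131459, 775, 391]

theorem mem_shift7 (j : ZMod 7) (σ : Finset (Fin 3 × ZMod 7)) (p : Fin 3 × ZMod 7) :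
    p ∈ shift7 j σ ↔ (p.1, p.2 - j) ∈ σ := by
  simp only [shift7, Finset.mem_image]
  constructor
  · rintro ⟨q, hq, rfl⟩
    simpa using hq
  · intro h
    exact ⟨_, h, by simp⟩

theorem rot21_spec : ∀ j : ZMod 7, ∀ m ∈ baseM21, ∀ p : Fin 3 × ZMod 7,
    m.testBit (code21 (p.1, p.2 - j)) = (rot21 j.val m).testBit (code21 p) := by
  decide +kernel

theorem baseB21_eq : baseB21 = (baseM21.map dec21).toFinset := by
  have h : baseM21.map dec21 = [
    {a 0, a 1, a 2, b 0, b 1, c 0}, {a 0, a 1, a 2, b 1, b 2, c 0},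
    {a 0, a 1, a 2, a 3, b 1, b 2}, {a 0, a 1, b 0, b 1, c 0, c 3},
    {a 0, b 0, b 1, b 3, c 0, c 3}, {a 0, b 0, b 3, c 0, c 3, c 4},
    {a 3, b 0, b 3, c 0, c 3, c 4}, {a 3, b 3, c 0, c 3, c 4, c 6}] := by
    decide +kernel
  rw [h]
  simp only [List.toFinset_cons, List.toFinset_nil, baseB21]
  rfl

theorem mem_B21 (σ : Finset (Fin 3 × ZMod 7)) :
    σ ∈ B21 ↔ ∃ j : ZMod 7, ∃ m ∈ baseM21, dec21 (rot21 j.val m) = σ := by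
  have h : ∀ j : ZMod 7, ∀ m ∈ baseM21, shift7 j (dec21 m) = dec21 (rot21 j.val m) := by
    intro j m hm
    ext p
    rw [mem_shift7, mem_dec21, mem_dec21, rot21_spec j m hm p]
  simp only [B21, baseB21_eq, Finset.mem_biUnion, Finset.mem_univ, true_and, Finset.mem_image,
    List.mem_toFinset, List.mem_map]
  constructor
  · rintro ⟨j, _, ⟨m, hm, rfl⟩, rfl⟩
    exact ⟨j, m, hm, (h j m hm).symm⟩
  · rintro ⟨j, m, hm, rfl⟩
    exact ⟨j, _, ⟨m, hm, rfl⟩, h j m hm⟩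

theorem erase_dec21 (m : ℕ) (x : Fin 3 × ZMod 7) (hx : m.testBit (code21 x) = true) :
    (dec21 m).erase x = dec21 (m ^^^ 2 ^ code21 x) := by
  ext p
  rw [Finset.mem_erase, mem_dec21, mem_dec21, Nat.testBit_xor, Nat.testBit_two_pow]
  by_cases h : p = x
  · subst h; simp [hx]
  · have : code21 x ≠ code21 p := fun e => h (code21_inj _ _ e.symm)
    simp [h, this]

theorem links21_chk : ∀ (t : Fin 3) (j : ZMod 7),
    chk21 ((linkM21 t).map (rot21 j.val)) = true := by
  decide +kernel

theorem links21_lt : ∀ (t : Fin 3) (j : ZMod 7),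
    ∀ m ∈ (linkM21 t).map (rot21 j.val), m < 2 ^ 21 := by
  decide +kernel

theorem links21_sub : ∀ (t : Fin 3) (j i : ZMod 7), ∀ m ∈ baseM21,
    (rot21 i.val m).testBit (code21 (t, j)) = true →
    (rot21 i.val m) ^^^ 2 ^ code21 (t, j) ∈ (linkM21 t).map (rot21 j.val) := by
  decide +kernel

theorem links21_sup : ∀ (t : Fin 3) (j : ZMod 7), ∀ n ∈ (linkM21 t).map (rot21 j.val),
    ∃ i : ZMod 7, ∃ m ∈ baseM21, (rot21 i.val m).testBit (code21 (t, j)) = true ∧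
      (rot21 i.val m) ^^^ 2 ^ code21 (t, j) = n := by
  decide +kernel

theorem links21_eq (t : Fin 3) (j : ZMod 7) :
    linkFacets B21 (t, j) = (((linkM21 t).map (rot21 j.val)).map dec21).toFinset := by
  ext σ
  rw [List.mem_toFinset, List.mem_map]
  simp only [linkFacets, Finset.mem_image, Finset.mem_filter, mem_B21]
  constructor
  · rintro ⟨_, ⟨⟨i, m, hm, rfl⟩, hx⟩, rfl⟩
    rw [mem_dec21] at hx
    exact ⟨_, links21_sub t j i m hm hx, (erase_dec21 _ _ hx).symm⟩
  · rintro ⟨n, hn, rfl⟩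
    obtain ⟨i, m, hm, hx, rfl⟩ := links21_sup t j n hn
    exact ⟨_, ⟨⟨i, m, hm, rfl⟩, (mem_dec21 _ _).2 hx⟩, erase_dec21 _ _ hx⟩

theorem pc21_base : ∀ j : ZMod 7, ∀ m ∈ baseM21, pc21 (rot21 j.val m) = 6 := by
  decide +kernel

theorem nb21 : ∀ x y : Fin 3 × ZMod 7, ∃ j : ZMod 7, ∃ m ∈ baseM21,
    (rot21 j.val m).testBit (code21 x) = true ∧ (rot21 j.val m).testBit (code21 y) = true := by
  decide +kernel

theorem B21_card : ∀ σ ∈ B21, σ.card = 6 := by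
  intro σ hσ
  obtain ⟨j, m, hm, rfl⟩ := (mem_B21 σ).1 hσ
  rw [card_dec21, pc21_base j m hm]

theorem B21_nb : ∀ x y : Fin 3 × ZMod 7, ∃ σ ∈ B21, x ∈ σ ∧ y ∈ σ := by
  intro x y
  obtain ⟨j, m, hm, hx, hy⟩ := nb21 x y
  exact ⟨_, (mem_B21 _).2 ⟨j, m, hm, rfl⟩, (mem_dec21 _ _).2 hx, (mem_dec21 _ _).2 hy⟩

/-- `B⁵₂₁` is a pure 5-dimensional complex on the 21-element vertex
set `V₂₁` which is 2-neighborly and all of whose vertex links are stacked 4-balls,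
i.e. it is a neighborly member of `K̄(5)`. -/
theorem stmt11 :
    (∀ σ ∈ B21, σ.card = 6) ∧
      vertexSet B21 = (Finset.univ : Finset (Fin 3 × ZMod 7)) ∧
      (∀ x y : Fin 3 × ZMod 7, ∃ σ ∈ B21, x ∈ σ ∧ y ∈ σ) ∧
      (∀ x : Fin 3 × ZMod 7, IsStackedBall 4 (linkFacets B21 x)) := by
  refine ⟨B21_card, ?_, B21_nb, ?_⟩
  · ext x
    obtain ⟨σ, hσ, hx, -⟩ := B21_nb x x
    simp only [vertexSet, Finset.mem_biUnion, Finset.mem_univ, iff_true]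
    exact ⟨σ, hσ, hx⟩
  · rintro ⟨t, j⟩
    rw [links21_eq]
    exact chk21_stacked _ (links21_lt t j) (links21_chk t j)
end

section
/- Let A⁵₄₁ be the pure 5-dimensional simplicial complex on the 41-element vertex set V₄₁ = {a₀, a₁, …, a₄₀} whose 246 facets are the images under the Z₄₁-action (j·a_k = a_{j+k}, indices mod 41) of the six facets a₃₆a₃₇a₃₈a₃₉a₄₀a₀, a₃₆a₃₇a₃₈a₃₉a₀a₆, a₃₇a₃₈a₃₉a₀a₆a₁₃, a₃₈a₃₉a₀a₆a₁₃a₂₀, a₃₉a₀a₆a₁₃a₂₀a₂₇, a₆a₁₃a₂₀a₂₇a₃₄a₀. Then A⁵₄₁ is 2-neighborly and every vertex link of A⁵₄₁ is a stacked 4-ball (i.e., A⁵₄₁ is a neighborly member of K̄(5)). -/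
variable {V : Type*} [DecidableEq V]

/-- The `Z₄₁`-action `j ⬝ a_k = a_{j+k}` on `V₄₁ = Z₄₁`. -/
def shift41 (j : ZMod 41) (σ : Finset (ZMod 41)) : Finset (ZMod 41) :=
  σ.image fun p => p + j

/-- The six basic facets of `A⁵₄₁`. -/
def baseA41 : Finset (Finset (ZMod 41)) :=
  { {36, 37, 38, 39, 40, 0}, {36, 37, 38, 39, 0, 6}, {37, 38, 39, 0, 6, 13},
    {38, 39, 0, 6, 13, 20}, {39, 0, 6, 13, 20, 27}, {6, 13, 20, 27, 34, 0} }

/-- The facet set of `A⁵₄₁` : all `Z₄₁`-images of the six basic facets. -/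
def A41 : Finset (Finset (ZMod 41)) :=
  (Finset.univ : Finset (ZMod 41)).biUnion fun j => baseA41.image (shift41 j)

theorem IsStackedBall.image_inj {W : Type*} [DecidableEq W] (f : V → W) (hf : Function.Injective f)
    {d : ℕ} {F : Finset (Finset V)} (h : IsStackedBall d F) :
    IsStackedBall d (F.image fun s => s.image f) := by
  induction h with
  | single σ h =>
    rw [Finset.image_singleton]
    exact .single _ _ (by rw [Finset.card_image_of_injective _ hf, h])
  | glue F σ τ _ h1 h2 h3 h4 h5 h6 ih =>
    rw [Finset.image_insert]
    refine .glue _ _ _ (τ.image f) ih ?_ ?_ ?_ ?_ ?_ ?_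
    · rw [Finset.card_image_of_injective _ hf, h1]
    · intro h
      obtain ⟨ρ, hρ, e⟩ := Finset.mem_image.1 h
      exact h2 (Finset.image_injective hf e ▸ hρ)
    · exact Finset.image_subset_image h3
    · rw [Finset.card_image_of_injective _ hf, h4]
    · obtain ⟨ρ, ⟨hρ, hs⟩, hu⟩ := h5
      refine ⟨ρ.image f, ⟨Finset.mem_image_of_mem _ hρ, Finset.image_subset_image hs⟩, ?_⟩
      rintro _ ⟨hy, hys⟩
      obtain ⟨ρ', hρ', rfl⟩ := Finset.mem_image.1 hy
      have := hu ρ' ⟨hρ', (Finset.image_subset_image_iff hf).1 hys⟩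
      rw [this]
    · intro ρ hρ
      obtain ⟨ρ', hρ', rfl⟩ := Finset.mem_image.1 hρ
      rw [← Finset.image_inter _ _ hf]
      exact Finset.image_subset_image (h6 _ hρ')

/-- A checker for stacked balls: each entry is a facet and its new vertex. -/
def chkStack (d : ℕ) : List (Finset V × V) → Bool
  | [] => false
  | [p] => decide (p.1.card = d + 1)
  | p :: q :: l => chkStack d (q :: l) && decide (p.1.card = d + 1) && decide (p.2 ∈ p.1) &&
      decide (∃ r ∈ q :: l, p.1.erase p.2 ⊆ r.1 ∧
        ∀ r' ∈ q :: l, p.1.erase p.2 ⊆ r'.1 → r'.1 = r.1) &&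
      decide (∀ r ∈ q :: l, p.2 ∉ r.1)

theorem chkStack_sound (d : ℕ) : ∀ l : List (Finset V × V), chkStack d l = true →
    IsStackedBall d (l.map Prod.fst).toFinset
  | [], h => by simp [chkStack] at h
  | [p], h => by
    simp only [chkStack, decide_eq_true_eq] at h
    simpa using IsStackedBall.single d p.1 h
  | p :: q :: l, h => by
    simp only [chkStack, Bool.and_eq_true, decide_eq_true_eq] at h
    obtain ⟨⟨⟨⟨h0, h1⟩, h2⟩, r, hr, hrs, hu⟩, h4⟩ := h
    have ih := chkStack_sound d (q :: l) h0
    rw [List.map_cons, List.toFinset_cons]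
    generalize q :: l = m at *
    have mem : ∀ ρ, ρ ∈ (m.map Prod.fst).toFinset ↔ ∃ r ∈ m, r.1 = ρ := by
      intro ρ; rw [List.mem_toFinset, List.mem_map]
    refine .glue d _ _ (p.1.erase p.2) ih h1 ?_ (Finset.erase_subset _ _) ?_ ?_ ?_
    · intro h
      obtain ⟨r, hr, e⟩ := (mem _).1 h
      exact h4 r hr (e ▸ h2)
    · rw [Finset.card_erase_of_mem h2, h1]; rfl
    · refine ⟨r.1, ⟨(mem _).2 ⟨r, hr, rfl⟩, hrs⟩, ?_⟩
      rintro _ ⟨hy, hys⟩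
      obtain ⟨r', hr', rfl⟩ := (mem _).1 hy
      exact hu r' hr' hys
    · intro ρ hρ
      obtain ⟨r, hr, rfl⟩ := (mem _).1 hρ
      intro v hv
      rw [Finset.mem_inter] at hv
      rw [Finset.mem_erase]
      exact ⟨fun e => h4 r hr (e ▸ hv.1), hv.2⟩

/-- The link of the vertex `0`, in a stacking order (last entry first). -/
def linkL : List (List (ZMod 41) × ZMod 41) :=
  [ ([30, 31, 32, 33, 35], 30), ([7, 31, 32, 33, 35], 31), ([7, 14, 32, 33, 35], 32),
    ([7, 14, 21, 33, 35], 33), ([18, 19, 21, 27, 34], 18), ([7, 19, 21, 27, 34], 19),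
    ([24, 25, 26, 28, 34], 24), ([7, 25, 26, 28, 34], 25), ([7, 14, 21, 28, 35], 35),
    ([7, 14, 26, 28, 34], 26), ([7, 14, 21, 28, 34], 28), ([7, 14, 21, 27, 34], 21),
    ([12, 14, 20, 27, 34], 12), ([7, 14, 20, 27, 34], 14), ([7, 13, 20, 27, 34], 7),
    ([6, 13, 20, 27, 34], 34), ([6, 13, 20, 27, 39], 27), ([6, 13, 20, 38, 39], 20),
    ([2, 8, 15, 22, 29], 29), ([2, 8, 15, 22, 40], 22), ([2, 8, 15, 39, 40], 15),
    ([6, 13, 37, 38, 39], 13), ([6, 36, 37, 38, 39], 6), ([2, 8, 38, 39, 40], 8),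
    ([36, 37, 38, 39, 40], 36), ([1, 37, 38, 39, 40], 37), ([1, 2, 38, 39, 40], 38),
    ([1, 3, 9, 16, 23], 23), ([1, 3, 9, 16, 40], 16), ([1, 3, 9, 39, 40], 9),
    ([1, 2, 3, 39, 40], 39), ([1, 2, 4, 10, 17], 17), ([1, 2, 4, 10, 40], 10),
    ([1, 2, 3, 4, 40], 40), ([1, 2, 3, 4, 5], 4), ([1, 2, 3, 5, 11], 1) ]

/-- The same list, with finsets. -/
def link0 : List (Finset (ZMod 41) × ZMod 41) := linkL.map fun m => (m.1.toFinset, m.2)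

theorem mem_A41 (σ : Finset (ZMod 41)) :
    σ ∈ A41 ↔ ∃ j, ∃ b ∈ baseA41, shift41 j b = σ := by
  simp [A41]

theorem link0_stacked : IsStackedBall 4 (link0.map Prod.fst).toFinset :=
  chkStack_sound 4 link0 (by decide +kernel)

/-- The basic facets as lists. -/
def baseL : List (List (ZMod 41)) :=
  [[36, 37, 38, 39, 40, 0], [36, 37, 38, 39, 0, 6], [37, 38, 39, 0, 6, 13],
    [38, 39, 0, 6, 13, 20], [39, 0, 6, 13, 20, 27], [6, 13, 20, 27, 34, 0]]

theorem mem_base (b : Finset (ZMod 41)) : b ∈ baseA41 ↔ ∃ l ∈ baseL, l.toFinset = b := by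
  simp only [baseA41, baseL, Finset.mem_insert, Finset.mem_singleton, List.mem_cons,
    List.not_mem_nil, or_false, exists_eq_or_imp, exists_eq_left, List.toFinset_cons,
    List.toFinset_nil, insert_empty_eq, eq_comm (a := b)]

/-- Equality test on lists as sets. -/
def sameL (l m : List (ZMod 41)) : Bool := l.all (fun x => m.elem x) && m.all (fun x => l.elem x)

theorem sameL_sound {l m : List (ZMod 41)} (h : sameL l m = true) : l.toFinset = m.toFinset := by
  simp only [sameL, Bool.and_eq_true, List.all_eq_true, List.elem_eq_mem,
    decide_eq_true_eq] at h
  ext x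
  rw [List.mem_toFinset, List.mem_toFinset]
  exact ⟨h.1 x, h.2 x⟩

/-- The link facet obtained from a basic facet and one of its vertices. -/
def lk (l : List (ZMod 41)) (p : ZMod 41) : List (ZMod 41) :=
  (l.map fun v => v + -p).filter fun v => !(v == 0)

theorem lk_eq (l : List (ZMod 41)) (p : ZMod 41) :
    (lk l p).toFinset = (shift41 (-p) l.toFinset).erase 0 := by
  ext x
  simp only [lk, shift41, List.mem_toFinset, List.mem_filter, List.mem_map, Finset.mem_erase,
    Finset.mem_image]
  simp [and_comm]

theorem chk_a : (baseL.all fun l => l.all fun p => linkL.any fun m => sameL m.1 (lk l p)) = true := by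
  decide +kernel

theorem chk_b : (linkL.all fun m => baseL.any fun l => l.any fun p => sameL (lk l p) m.1) = true := by
  decide +kernel

theorem link0_a : ∀ b ∈ baseA41, ∀ p ∈ b,
    (shift41 (-p) b).erase 0 ∈ link0.map Prod.fst := by
  intro b hb p hp
  obtain ⟨l, hl, rfl⟩ := (mem_base b).1 hb
  have h := chk_a
  simp only [List.all_eq_true, List.any_eq_true] at h
  obtain ⟨m, hm, e⟩ := h l hl p (List.mem_toFinset.1 hp)
  rw [← lk_eq, ← sameL_sound e]
  exact List.mem_map.2 ⟨_, List.mem_map.2 ⟨m, hm, rfl⟩, rfl⟩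

theorem link0_b : ∀ σ ∈ link0.map Prod.fst, ∃ b ∈ baseA41, ∃ p ∈ b,
    (shift41 (-p) b).erase 0 = σ := by
  intro σ hσ
  obtain ⟨_, h1, rfl⟩ := List.mem_map.1 hσ
  obtain ⟨m, hm, rfl⟩ := List.mem_map.1 h1
  have h := chk_b
  simp only [List.all_eq_true, List.any_eq_true] at h
  obtain ⟨l, hl, p, hp, e⟩ := h m hm
  exact ⟨_, (mem_base _).2 ⟨l, hl, rfl⟩, p, List.mem_toFinset.2 hp, by
    rw [← lk_eq, sameL_sound e]⟩

theorem mem_shift41 (i x : ZMod 41) (σ : Finset (ZMod 41)) : x ∈ shift41 i σ ↔ x - i ∈ σ := by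
  simp only [shift41, Finset.mem_image]
  constructor
  · rintro ⟨a, ha, rfl⟩; simpa using ha
  · intro h; exact ⟨_, h, by simp⟩

theorem link0_eq : linkFacets A41 0 = (link0.map Prod.fst).toFinset := by
  ext σ
  simp only [linkFacets, Finset.mem_image, Finset.mem_filter, mem_A41]
  rw [List.mem_toFinset]
  constructor
  · rintro ⟨_, ⟨⟨j, b, hb, rfl⟩, h0⟩, rfl⟩
    rw [mem_shift41, zero_sub] at h0
    simpa using link0_a b hb (-j) h0
  · intro h
    obtain ⟨b, hb, p, hp, e⟩ := link0_b σ h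
    exact ⟨_, ⟨⟨-p, b, hb, rfl⟩, by rw [mem_shift41]; simpa using hp⟩, e⟩

theorem shift41_shift41 (i j : ZMod 41) (σ : Finset (ZMod 41)) :
    shift41 i (shift41 j σ) = shift41 (j + i) σ := by
  simp only [shift41, Finset.image_image]
  congr 1
  funext p
  simp [add_assoc]

theorem shift41_mem_A41 (i : ZMod 41) {σ : Finset (ZMod 41)} (h : σ ∈ A41) :
    shift41 i σ ∈ A41 := by
  obtain ⟨j, b, hb, rfl⟩ := (mem_A41 _).1 h
  exact (mem_A41 _).2 ⟨j + i, b, hb, (shift41_shift41 i j b).symm⟩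

theorem shift41_zero (σ : Finset (ZMod 41)) : shift41 0 σ = σ := by
  simp [shift41]

theorem link_eq (x : ZMod 41) : linkFacets A41 x = (linkFacets A41 0).image (shift41 x) := by
  ext σ
  simp only [linkFacets, Finset.mem_image, Finset.mem_filter]
  constructor
  · rintro ⟨s, ⟨hs, hx⟩, rfl⟩
    refine ⟨_, ⟨shift41 (-x) s, ⟨shift41_mem_A41 _ hs, ?_⟩, rfl⟩, ?_⟩
    · rw [mem_shift41]; simpa using hx
    · ext v
      simp [mem_shift41, Finset.mem_erase, sub_eq_zero]
  · rintro ⟨_, ⟨s, ⟨hs, hx⟩, rfl⟩, rfl⟩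
    refine ⟨shift41 x s, ⟨shift41_mem_A41 _ hs, ?_⟩, ?_⟩
    · rw [mem_shift41]; simpa using hx
    · ext v
      simp [mem_shift41, Finset.mem_erase, sub_eq_zero]

theorem base_card : ∀ b ∈ baseA41, b.card = 6 := by
  intro b hb
  obtain ⟨l, hl, rfl⟩ := (mem_base b).1 hb
  have h : (baseL.all fun l => decide (l.toFinset.card = 6)) = true := by decide +kernel
  simp only [List.all_eq_true, decide_eq_true_eq] at h
  exact h l hl

theorem nb0 : ∀ y : Fin 41, ∃ b ∈ baseA41, ∃ p ∈ b, (show ZMod 41 from y) + p ∈ b := by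
  have h : ∀ y : Fin 41, (baseL.any fun l => l.any fun p =>
      l.elem ((show ZMod 41 from y) + p)) = true := by decide +kernel
  intro y
  have h := h y
  simp only [List.any_eq_true, List.elem_eq_mem, decide_eq_true_eq] at h
  obtain ⟨l, hl, p, hp, hy⟩ := h
  exact ⟨_, (mem_base _).2 ⟨l, hl, rfl⟩, p, List.mem_toFinset.2 hp, List.mem_toFinset.2 hy⟩

theorem nb (x y : ZMod 41) : ∃ σ ∈ A41, x ∈ σ ∧ y ∈ σ := by
  obtain ⟨b, hb, p, hp, hy⟩ := nb0 (show Fin 41 from (y - x : ZMod 41))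
  change y - x + p ∈ b at hy
  refine ⟨shift41 (x - p) b, (mem_A41 _).2 ⟨_, b, hb, rfl⟩, ?_, ?_⟩
  · rw [mem_shift41]; simpa using hp
  · rw [mem_shift41]
    have e : y - (x - p) = y - x + p := by ring
    rwa [e]

/-- `A⁵₄₁` is a pure 5-dimensional complex on the 41-element vertex
set `V₄₁` which is 2-neighborly and all of whose vertex links are stacked 4-balls,
i.e. it is a neighborly member of `K̄(5)`. -/
theorem stmt13 :
    (∀ σ ∈ A41, σ.card = 6) ∧
      vertexSet A41 = (Finset.univ : Finset (ZMod 41)) ∧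
      (∀ x y : ZMod 41, ∃ σ ∈ A41, x ∈ σ ∧ y ∈ σ) ∧
      (∀ x : ZMod 41, IsStackedBall 4 (linkFacets A41 x)) := by
  refine ⟨?_, ?_, nb, ?_⟩
  · intro σ h
    obtain ⟨j, b, hb, rfl⟩ := (mem_A41 _).1 h
    rw [shift41, Finset.card_image_of_injective _ (add_left_injective j)]
    exact base_card b hb
  · ext x
    obtain ⟨σ, h, hx, _⟩ := nb x x
    simp only [vertexSet, Finset.mem_biUnion, Finset.mem_univ, iff_true]
    exact ⟨σ, h, hx⟩
  · intro x
    rw [link_eq, link0_eq]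
    exact link0_stacked.image_inj (fun p => p + x) (add_left_injective x)
end

section
/- Let M⁴₂₁ = ∂A⁵₂₁ be the boundary complex of A⁵₂₁, where A⁵₂₁ is the pure 5-dimensional simplicial complex on V₂₁ = {a_i, b_i, c_i : i ∈ Z₇} whose 56 facets are the Z₇-images (indices mod 7) of a₀a₁a₂b₀b₁c₀, a₁a₂b₀b₁b₂c₀, a₁a₂a₃b₀b₁b₂, a₀a₁b₀b₁c₀c₃, a₀a₁b₀b₃c₀c₃, a₀b₀b₃c₀c₃c₄, a₀a₃b₃c₀c₃c₄, a₃b₃c₀c₃c₄c₆. Then M⁴₂₁ is a 2-neighborly 4-dimensional weak pseudomanifold on 21 vertices, every vertex link of M⁴₂₁ is a stacked 3-sphere (i.e., M⁴₂₁ ∈ K(4)), its face vector is (f₀, f₁, f₂, f₃, f₄) = (21, 210, 490, 525, 210), and its Euler characteristic is χ = −14, so that f₀(f₀ − 11) = −15χ. -/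
variable {V : Type*} [DecidableEq V]

/-- The facet set of the boundary complex. -/
def M21 : Finset (Finset (Fin 3 × ZMod 7)) := bdryFacets 5 A21

namespace P21

abbrev W := Fin 3 × ZMod 7

def code (p : W) : ℕ := 7 * p.1.val + p.2.val

def dec (n : ℕ) : Finset W := Finset.univ.filter fun v => n.testBit (code v) = true

def decS (L : List ℕ) : Finset (Finset W) := L.toFinset.image dec

def popc (n : ℕ) : ℕ := ((List.range 21).filter fun i => n.testBit i).length

def subs (n : ℕ) : List ℕ := ((List.range 21).filter fun i => n.testBit i).map fun i => n ^^^ 2 ^ i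

def sub (n m : ℕ) : Bool := Nat.beq (n &&& m) n

inductive T where
  | nil : T
  | node : T → ℕ → T → T

def T.ins (x : ℕ) : T → T
  | .nil => .node .nil x .nil
  | .node l y r => bif Nat.blt x y then .node (T.ins x l) y r else
      bif Nat.blt y x then .node l y (T.ins x r) else .node l y r

def T.toL : T → List ℕ
  | .nil => []
  | .node l y r => l.toL ++ y :: r.toL

def T.find (x : ℕ) : T → Bool
  | .nil => false
  | .node l y r => bif Nat.blt x y then T.find x l else
      bif Nat.blt y x then T.find x r else true

def srt (L : List ℕ) : List ℕ := (L.foldr T.ins .nil).toL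

def down (L : List ℕ) : List ℕ := srt (L.flatMap subs)

def bdryL (L : List ℕ) : List ℕ :=
  (down L).filter fun n => Nat.beq ((L.filter fun m => sub n m).length) 1

def linkL (L : List ℕ) (i : ℕ) : List ℕ :=
  srt ((L.filter fun n => n.testBit i).map fun n => n ^^^ 2 ^ i)

def incr : List ℕ → Bool
  | [] => true
  | [_] => true
  | x :: y :: L => Nat.blt x y && incr (y :: L)

/-- all entries are legal codes of `k`-sets. -/
def good (k : ℕ) (L : List ℕ) : Bool := L.all fun n => Nat.blt n 2097152 && Nat.beq (popc n) k

def stackOK : List ℕ → Bool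
  | [] => false
  | n :: L => (Nat.blt n 2097152 && Nat.beq (popc n) 5) &&
      (L.isEmpty || (stackOK L && (!(L.contains n) && L.any fun r =>
        Nat.beq (popc (r &&& n)) 4 && L.all fun q =>
          sub (q &&& n) (r &&& n) && (!(sub (r &&& n) q) || Nat.beq q r))))

def rot7 (j n : ℕ) : ℕ := ((n <<< j) ||| (n >>> (7 - j))) &&& 127

def rot (j n : ℕ) : ℕ :=
  rot7 j (n &&& 127) ||| (rot7 j ((n >>> 7) &&& 127) <<< 7) ||| (rot7 j ((n >>> 14) &&& 127) <<< 14)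

def LB : List ℕ := [16775, 17286, 910, 147843, 148611, 410753, 410633, 1459208]

def LA : List ℕ := (List.range 7).flatMap fun j => LB.map (rot j)

def LM : List ℕ :=
  [398, 654, 796, 906, 908, 1308, 1592, 1812, 1816, 2616, 3184, 3624, 3632, 4291, 5232, 6241,
   7248, 7264, 8327, 8455, 8581, 8582, 10337, 12355, 12419, 12482, 14369, 14401, 16519, 16647,
   16773, 17030, 17158, 17282, 17284, 17539, 18608, 22576, 33038, 33294, 33546, 34060, 34316,
   34564, 34568, 35078, 37216, 45152, 49297, 51344, 66076, 66588, 67092, 68120, 68632, 69128,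
   69136, 70156, 73921, 74305, 98594, 102688, 131459, 132152, 132227, 133176, 134184, 136240,
   137264, 138256, 138272, 140312, 147715, 147841, 147842, 148483, 148489, 148610, 155720,
   156680, 180353, 197188, 205376, 221248, 262918, 264304, 264368, 264454, 266352, 268368,
   272480, 274528, 276512, 276544, 278673, 278704, 279561, 279681, 280736, 282672, 284688,
   284704, 295057, 295430, 295682, 295684, 296966, 296978, 297104, 297220, 311313, 313472,
   360706, 394249, 394369, 409609, 410752, 426113, 442369, 442496, 525836, 528481, 528577,
   528736, 528908, 532577, 532673, 536609, 536705, 536768, 557346, 557408, 559122, 559362,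
   561472, 565344, 569376, 569408, 575504, 590114, 590860, 591364, 591368, 593932, 593956,
   594208, 594440, 622626, 626944, 721412, 788498, 788738, 804880, 819218, 821504, 835600,
   837632, 852226, 884738, 884992, 1048771, 1048963, 1051672, 1056835, 1056962, 1057027,
   1057153, 1057154, 1057345, 1057816, 1073224, 1074184, 1114305, 1114689, 1114692, 1118244,
   1118724, 1122433, 1122496, 1122817, 1138752, 1151008, 1180228, 1181720, 1182728, 1182736,
   1187864, 1187912, 1188416, 1188880, 1196104, 1205248, 1245252, 1253888, 1261632, 1269760,
   1328136, 1442824, 1458184, 1459200, 1576996, 1577476, 1609760, 1638436, 1643008, 1671200,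
   1675264, 1704452, 1769476, 1769984]

local notation "o" => T.nil
local notation "N" => T.node

def T4 : T :=
  (N (N (N (N (N (N (N (N (N (N o 135 o) 142 o) 195 (N o 263 o)) 270 (N (N o 284 o) 387 (N o
   389 o))) 390 (N (N (N o 394 o) 396 (N o 526 o)) 540 (N (N o 568 o) 646 (N o 650 o)))) 652 (N
   (N (N (N o 774 o) 778 (N o 780 o)) 788 (N (N o 792 o) 898 (N o 900 o))) 904 (N (N (N o 1052
   o) 1080 (N o 1136 o)) 1155 (N (N o 1292 o) 1300 (N o 1304 o))))) 1548 (N (N (N (N (N (N o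
   1556 o) 1560 o) 1576 (N o 1584 o)) 1796 (N (N o 1800 o) 1808 (N o 2104 o))) 2145 (N (N (N o
   2160 o) 2224 (N o 2310 o)) 2584 (N (N o 2600 o) 2608 (N o 3096 o)))) 3112 (N (N (N (N o 3120
   o) 3152 (N o 3168 o)) 3592 (N (N o 3600 o) 3616 (N o 4163 o))) 4193 (N (N (N o 4208 o) 4227
   (N o 4289 o)) 4290 (N (N o 4448 o) 4620 (N o 5168 o)))))) 5200 (N (N (N (N (N (N (N o 5216
   o) 6177 o) 6192 (N o 6209 o)) 6224 (N (N o 6240 o) 7184 (N o 7200 o))) 7232 (N (N (N o 8199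
   o) 8259 (N o 8289 o)) 8323 (N (N o 8325 o) 8326 (N o 8385 o)))) 8386 (N (N (N (N o 8451 o)
   8453 (N o 8454 o)) 8577 (N (N o 8578 o) 8580 (N o 8769 o))) 9240 (N (N (N o 10273 o) 10305
   (N o 10336 o)) 12291 (N (N o 12321 o) 12353 (N o 12354 o))))) 12384 (N (N (N (N (N (N o
   12417 o) 12418 o) 12480 (N o 14337 o)) 14368 (N (N o 14400 o) 16391 (N o 16515 o))) 16517 (N
   (N (N o 16518 o) 16529 (N o 16560 o)) 16643 (N (N o 16645 o) 16646 (N o 16769 o)))) 16770 (N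
   (N (N (N o 16772 o) 16902 (N o 17026 o)) 17028 (N (N o 17154 o) 17156 (N o 17280 o))) 17411
   (N (N (N o 17417 o) 17537 (N o 17538 o)) 18480 (N (N o 18576 o) 18592 (N o 20528 o)))))))
   22544 (N (N (N (N (N (N (N (N o 22560 o) 24648 o) 25608 (N o 32782 o)) 32913 (N (N o 33030
   o) 33034 (N o 33036 o))) 33058 (N (N (N o 33120 o) 33286 (N o 33290 o)) 33292 (N (N o 33538
   o) 33540 (N o 33544 o)))) 33804 (N (N (N (N o 34052 o) 34056 (N o 34308 o)) 34312 (N (N o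
   34560 o) 34822 (N o 34834 o))) 34960 (N (N (N o 35074 o) 35076 (N o 36960 o)) 37152 (N (N o
   37184 o) 41056 (N o 45088 o))))) 45120 (N (N (N (N (N (N o 49169 o) 49281 o) 49296 (N o
   51216 o)) 51328 (N (N o 65564 o) 65729 (N o 65826 o))) 66060 (N (N (N o 66068 o) 66072 (N o
   66113 o)) 66116 (N (N o 66572 o) 66580 (N o 66584 o)))) 67076 (N (N (N (N o 67080 o) 67088
   (N o 67608 o)) 68104 (N (N o 68112 o) 68616 (N o 68624 o))) 69120 (N (N (N o 69644 o) 69668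
   (N o 69920 o)) 70148 (N (N o 70152 o) 73793 (N o 73857 o)))))) 73920 (N (N (N (N (N (N (N o
   74241 o) 74304 o) 90176 (N o 98338 o)) 98562 (N (N o 98592 o) 102432 (N o 102656 o))) 131128
   (N (N (N o 131203 o) 131331 (N o 131457 o)) 131458 (N (N o 131652 o) 132099 (N o 132105
   o)))) 132120 (N (N (N (N o 132136 o) 132144 (N o 132225 o)) 132226 (N (N o 133144 o) 133160
   (N o 133168 o))) 134152 (N (N (N o 134160 o) 134176 (N o 135216 o)) 136208 (N (N o 136224 o)
   137232 (N o 137248 o))))) 138240 (N (N (N (N (N o 139288 o) 139336 (N o 139840 o)) 140296 (N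
   (N o 140304 o) 147459 (N o 147465 o))) 147528 (N (N (N o 147585 o) 147586 (N o 147713 o))
   147714 (N (N o 147840 o) 148481 (N o 148482 o)))) 148488 (N (N (N (N o 148608 o) 155656 (N o
   155712 o)) 156672 (N (N o 163969 o) 180225 (N o 180352 o))) 196676 (N (N (N o 197124 o)
   197184 (N o 204864 o)) 205312 (N (N o 213056 o) 221184 (N o 262256 o)))))))) 262289 (N (N (N
   (N (N (N (N (N (N o 262320 o) 262406 o) 262662 (N o 262914 o)) 262916 (N (N o 263177 o)
   263297 (N o 264198 o))) 264210 (N (N (N o 264240 o) 264272 (N o 264288 o)) 264336 (N (N o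
   264352 o) 264450 (N o 264452 o)))) 266288 (N (N (N (N o 266320 o) 266336 (N o 268304 o))
   268320 (N (N o 268352 o) 270432 (N o 272416 o))) 272448 (N (N (N o 274464 o) 274496 (N o
   276480 o)) 278537 (N (N o 278545 o) 278576 (N o 278657 o))))) 278672 (N (N (N (N (N (N o
   278688 o) 279553 o) 279560 (N o 279680 o)) 280592 (N (N o 280608 o) 280704 (N o 282640 o)))
   282656 (N (N (N o 284672 o) 294918 (N o 294929 o)) 294930 (N (N o 295041 o) 295056 (N o
   295170 o)))) 295172 (N (N (N (N o 295426 o) 295428 (N o 295680 o)) 296962 (N (N o 296964 o)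
   296976 (N o 297088 o))) 297216 (N (N (N o 311297 o) 311312 (N o 311424 o)) 313344 (N (N o
   327938 o) 360450 (N o 360704 o)))))) 393225 (N (N (N (N (N (N (N o 393345 o) 394241 o)
   394248 (N o 394368 o)) 409601 (N (N o 409608 o) 409728 (N o 410624 o))) 425985 (N (N (N o
   426112 o) 442368 (N o 524385 o)) 524481 (N (N o 524578 o) 524640 (N o 524812 o)))) 525324 (N
   (N (N (N o 525828 o) 525832 (N o 526354 o)) 526594 (N (N o 528396 o) 528417 (N o 528420 o)))
   528449 (N (N (N o 528480 o) 528513 (N o 528576 o)) 528672 (N (N o 528704 o) 528900 (N o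
   528904 o))))) 532513 (N (N (N (N (N (N o 532545 o) 532576 o) 532609 (N o 532672 o)) 536577
   (N (N o 536608 o) 536640 (N o 536704 o))) 542736 (N (N (N o 557074 o) 557090 (N o 557152 o))
   557314 (N (N o 557344 o) 557376 (N o 559106 o)))) 559120 (N (N (N (N o 559360 o) 561184 (N o
   561216 o)) 561408 (N (N o 565280 o) 565312 (N o 569344 o))) 573456 (N (N (N o 575488 o)
   589836 (N o 589858 o)) 589860 (N (N o 590082 o) 590112 (N o 590340 o))))))) 590344 (N (N (N
   (N (N (N (N (N o 590852 o) 590856 o) 591360 (N o 593924 o)) 593928 (N (N o 593952 o) 594176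
   (N o 594432 o))) 622594 (N (N (N o 622624 o) 622848 (N o 626688 o)) 655876 (N (N o 720900 o)
   721408 (N o 786450 o)))) 786690 (N (N (N (N o 788482 o) 788496 (N o 788736 o)) 802832 (N (N
   o 804864 o) 819202 (N o 819216 o))) 819456 (N (N (N o 821248 o) 835584 (N o 851970 o))
   852224 (N (N o 884736 o) 1048643 (N o 1048707 o))))) 1048769 (N (N (N (N (N (N o 1048770 o)
   1048835 o) 1048961 (N o 1048962 o)) 1049153 (N (N o 1049156 o) 1049624 (N o 1050648 o)))
   1051656 (N (N (N o 1051664 o) 1052708 (N o 1053188 o)) 1056771 (N (N o 1056792 o) 1056833 (N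
   o 1056834 o)))) 1056840 (N (N (N (N o 1056897 o) 1056898 (N o 1056960 o)) 1057025 (N (N o
   1057026 o) 1057152 (N o 1057281 o))) 1057344 (N (N (N o 1057800 o) 1057808 (N o 1065032 o))
   1065992 (N (N o 1073160 o) 1073216 (N o 1074176 o)))))) 1085472 (N (N (N (N (N (N (N o
   1114148 o) 1114177 o) 1114180 (N o 1114241 o)) 1114304 (N (N o 1114625 o) 1114628 (N o
   1114688 o))) 1118212 (N (N (N o 1118240 o) 1118720 (N o 1122305 o)) 1122368 (N (N o 1122432
   o) 1122816 (N o 1130560 o)))) 1138688 (N (N (N (N o 1146912 o) 1150976 (N o 1179672 o))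
   1179716 (N (N o 1179720 o) 1180164 (N o 1180224 o))) 1180680 (N (N (N o 1180688 o) 1181704
   (N o 1181712 o)) 1182720 (N (N o 1187848 o) 1187856 (N o 1187904 o))))) 1188352 (N (N (N (N
   (N o 1188864 o) 1196040 (N o 1196096 o)) 1197056 (N (N o 1204224 o) 1245188 (N o 1245248
   o))) 1245696 (N (N (N o 1253376 o) 1261568 (N o 1311752 o)) 1327112 (N (N o 1328128 o)
   1441800 (N o 1442816 o)))) 1458176 (N (N (N (N o 1572900 o) 1573380 (N o 1576964 o)) 1576992
   (N (N o 1577472 o) 1605664 (N o 1609728 o))) 1638404 (N (N (N o 1638432 o) 1638912 (N o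
   1642496 o)) 1671168 (N (N o 1703940 o) 1704448 (N o 1769472 o)))))))))

def T3 : T :=
  (N (N (N (N (N (N (N (N (N o 7 o) 14 (N o 28 o)) 56 (N (N o 67 o) 97 (N o 112 o))) 131 (N (N
   (N o 133 o) 134 (N o 138 o)) 140 (N (N o 145 o) 176 (N o 193 o)))) 194 (N (N (N (N o 259 o)
   261 (N o 262 o)) 266 (N (N o 268 o) 276 (N o 280 o))) 290 (N (N (N o 352 o) 385 (N o 386 o))
   388 (N (N o 392 o) 518 o)))) 522 (N (N (N (N (N o 524 o) 532 (N o 536 o)) 552 (N (N o 560 o)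
   577 (N o 580 o))) 642 (N (N (N o 644 o) 648 (N o 770 o)) 772 (N (N o 776 o) 784 (N o 896
   o)))) 1027 (N (N (N (N o 1033 o) 1036 (N o 1044 o)) 1048 (N (N o 1064 o) 1072 (N o 1104 o)))
   1120 (N (N (N o 1153 o) 1154 (N o 1284 o)) 1288 (N (N o 1296 o) 1540 o))))) 1544 (N (N (N (N
   (N (N o 1552 o) 1568 (N o 1792 o)) 2054 (N (N o 2066 o) 2072 (N o 2081 o))) 2088 (N (N (N o
   2096 o) 2113 (N o 2128 o)) 2144 (N (N o 2192 o) 2208 (N o 2306 o)))) 2308 (N (N (N (N o 2568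
   o) 2576 (N o 2592 o)) 3080 (N (N o 3088 o) 3104 (N o 3136 o))) 3584 (N (N (N o 4099 o) 4108
   (N o 4129 o)) 4132 (N (N o 4144 o) 4161 o)))) 4162 (N (N (N (N (N o 4176 o) 4192 (N o 4225
   o)) 4226 (N (N o 4288 o) 4384 (N o 4416 o))) 4612 (N (N (N o 4616 o) 5136 (N o 5152 o)) 5184
   (N (N o 6145 o) 6160 o))) 6176 (N (N (N (N o 6208 o) 7168 (N o 8195 o)) 8197 (N (N o 8198 o)
   8216 (N o 8225 o))) 8257 (N (N (N o 8258 o) 8264 (N o 8288 o)) 8321 (N (N o 8322 o) 8324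
   o)))))) 8384 (N (N (N (N (N (N (N o 8449 o) 8450 (N o 8452 o)) 8576 (N (N o 8705 o) 8768 (N
   o 9224 o))) 9232 (N (N (N o 10241 o) 10272 (N o 10304 o)) 12289 (N (N o 12290 o) 12320 (N o
   12352 o)))) 12416 (N (N (N (N o 14336 o) 16387 (N o 16389 o)) 16390 (N (N o 16393 o) 16401
   (N o 16432 o))) 16456 (N (N (N o 16513 o) 16514 (N o 16516 o)) 16528 (N (N o 16544 o) 16641
   o)))) 16642 (N (N (N (N (N o 16644 o) 16768 (N o 16898 o)) 16900 (N (N o 17024 o) 17152 (N o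
   17409 o))) 17410 (N (N (N o 17416 o) 17536 (N o 18448 o)) 18464 (N (N o 18560 o) 20496 (N o
   20512 o)))) 22528 (N (N (N (N o 24584 o) 24640 (N o 25600 o)) 32774 (N (N o 32778 o) 32780
   (N o 32785 o))) 32786 (N (N (N o 32802 o) 32864 (N o 32897 o)) 32912 (N (N o 33026 o) 33028
   o))))) 33032 (N (N (N (N (N (N o 33056 o) 33088 (N o 33282 o)) 33284 (N (N o 33288 o) 33536
   (N o 33796 o))) 33800 (N (N (N o 34048 o) 34304 (N o 34818 o)) 34820 (N (N o 34832 o) 34944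
   (N o 35072 o)))) 36896 (N (N (N (N o 36928 o) 37120 (N o 40992 o)) 41024 (N (N o 45056 o)
   49153 (N o 49168 o))) 49280 (N (N (N o 51200 o) 65548 (N o 65556 o)) 65560 (N (N o 65570 o)
   65572 o)))) 65601 (N (N (N (N (N o 65604 o) 65665 (N o 65728 o)) 65794 (N (N o 65824 o)
   66049 (N o 66052 o))) 66056 (N (N (N o 66064 o) 66112 (N o 66564 o)) 66568 (N (N o 66576 o)
   67072 o))) 67592 (N (N (N (N o 67600 o) 68096 (N o 68608 o)) 69636 (N (N o 69640 o) 69664 (N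
   o 69888 o))) 70144 (N (N (N o 73729 o) 73792 (N o 73856 o)) 74240 (N (N o 81984 o) 90112
   o))))))) 98306 (N (N (N (N (N (N (N (N o 98336 o) 98560 (N o 102400 o)) 131075 (N (N o
   131081 o) 131096 (N o 131112 o))) 131120 (N (N (N o 131140 o) 131144 (N o 131201 o)) 131202
   (N (N o 131329 o) 131330 (N o 131456 o)))) 131588 (N (N (N (N o 131648 o) 132097 (N o 132098
   o)) 132104 (N (N o 132112 o) 132128 (N o 132224 o))) 133128 (N (N (N o 133136 o) 133152 (N o
   134144 o)) 135184 (N (N o 135200 o) 136192 o)))) 137216 (N (N (N (N (N o 139272 o) 139280 (N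
   o 139328 o)) 139776 (N (N o 140288 o) 147457 (N o 147458 o))) 147464 (N (N (N o 147520 o)
   147584 (N o 147712 o)) 148480 (N (N o 155648 o) 163841 (N o 163968 o)))) 180224 (N (N (N (N
   o 196612 o) 196672 (N o 197120 o)) 204800 (N (N o 212992 o) 262150 (N o 262153 o))) 262161
   (N (N (N o 262162 o) 262192 (N o 262224 o)) 262240 (N (N o 262273 o) 262288 o))))) 262304 (N
   (N (N (N (N (N o 262402 o) 262404 (N o 262658 o)) 262660 (N (N o 262912 o) 263169 (N o
   263176 o))) 263296 (N (N (N o 264194 o) 264196 (N o 264208 o)) 264224 (N (N o 264256 o)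
   264320 (N o 264448 o)))) 266256 (N (N (N (N o 266272 o) 266304 (N o 268288 o)) 270368 (N (N
   o 270400 o) 272384 (N o 274432 o))) 278529 (N (N (N o 278536 o) 278544 (N o 278560 o))
   278656 (N (N o 279552 o) 280576 o)))) 282624 (N (N (N (N (N o 294913 o) 294914 (N o 294916
   o)) 294928 (N (N o 295040 o) 295168 (N o 295424 o))) 296960 (N (N (N o 311296 o) 327682 (N o
   327936 o)) 360448 (N (N o 393217 o) 393224 o))) 393344 (N (N (N (N o 394240 o) 409600 (N o
   425984 o)) 524300 (N (N o 524306 o) 524321 (N o 524322 o))) 524324 (N (N (N o 524353 o)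
   524384 (N o 524417 o)) 524480 (N (N o 524546 o) 524576 o)))))) 524608 (N (N (N (N (N (N (N o
   524804 o) 524808 (N o 525316 o)) 525320 (N (N o 525824 o) 526338 (N o 526352 o))) 526592 (N
   (N (N o 528385 o) 528388 (N o 528392 o)) 528416 (N (N o 528448 o) 528512 (N o 528640 o))))
   528896 (N (N (N (N o 532481 o) 532512 (N o 532544 o)) 532608 (N (N o 536576 o) 540688 (N o
   542720 o))) 557058 (N (N (N o 557072 o) 557088 (N o 557120 o)) 557312 (N (N o 559104 o)
   561152 o)))) 565248 (N (N (N (N (N o 573440 o) 589826 (N o 589828 o)) 589832 (N (N o 589856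
   o) 590080 (N o 590336 o))) 590848 (N (N (N o 593920 o) 622592 (N o 655364 o)) 655872 (N (N o
   720896 o) 786434 o))) 786448 (N (N (N (N o 786688 o) 788480 (N o 802816 o)) 819200 (N (N o
   851968 o) 1048579 (N o 1048600 o))) 1048612 (N (N (N o 1048641 o) 1048642 (N o 1048644 o))
   1048648 (N (N o 1048705 o) 1048706 o))))) 1048768 (N (N (N (N (N (N o 1048833 o) 1048834 (N
   o 1048960 o)) 1049089 (N (N o 1049092 o) 1049152 (N o 1049608 o))) 1049616 (N (N (N o
   1050632 o) 1050640 (N o 1051648 o)) 1052676 (N (N o 1052704 o) 1053184 (N o 1056769 o))))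
   1056770 (N (N (N (N o 1056776 o) 1056784 (N o 1056832 o)) 1056896 (N (N o 1057024 o) 1057280
   (N o 1057792 o))) 1064968 (N (N (N o 1065024 o) 1065984 (N o 1073152 o)) 1081376 (N (N o
   1085440 o) 1114113 o)))) 1114116 (N (N (N (N (N o 1114144 o) 1114176 (N o 1114240 o))
   1114624 (N (N o 1118208 o) 1122304 (N o 1130496 o))) 1146880 (N (N (N o 1179652 o) 1179656
   (N o 1179664 o)) 1179712 (N (N o 1180160 o) 1180672 o))) 1181696 (N (N (N (N o 1187840 o)
   1196032 (N o 1245184 o)) 1310728 (N (N o 1311744 o) 1327104 (N o 1441792 o))) 1572868 (N (N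
   (N o 1572896 o) 1573376 (N o 1576960 o)) 1605632 (N (N o 1638400 o) 1703936 o))))))))

def L4 : List ℕ := T4.toL
def L3 : List ℕ := T3.toL

def ball0 : Fin 3 → List ℕ
  | 0 => [311440, 442496, 410632, 410752, 1122880, 148610, 1122496, 147842, 14432, 536672, 536768, 12482, 1056962, 1057154, 8582, 16774]
  | 1 => [280624, 313360, 311313, 442369, 410625, 148483, 1122369, 147715, 536641, 12355, 1056835, 1057027, 8455, 782, 17158, 16647]
  | 2 => [821264, 268336, 264368, 297104, 295057, 426113, 1253440, 1187912, 1188872, 1442824, 394249, 394369, 132227, 131459, 902, 391]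

def ball (x : W) : List ℕ := (ball0 x.1).map (rot x.2.val)

/-! ### computations -/

theorem LA_eq : LA = (List.range 7).flatMap fun j => LB.map (rot j) := rfl
theorem L4_eq : L4 = T4.toL := rfl
theorem L3_eq : L3 = T3.toL := rfl
theorem hLA_good : good 6 LA = true := by decide +kernel
theorem hLM_good : good 5 LM = true := by decide +kernel
theorem hLM_incr : incr LM = true := by decide +kernel
theorem hLA_incr : incr (srt LA) = true ∧ (srt LA).length = 56 := by decide +kernel
theorem hbd : bdryL (srt LA) = LM := by decide +kernel
theorem hpm : (L4.all fun n => Nat.ble ((LM.filter fun m => sub n m).length) 2 &&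
    Nat.ble 1 ((LM.filter fun m => sub n m).length)) = true := by decide +kernel
theorem hnb : ((List.range 21).all fun i => (List.range 21).all fun j =>
    LM.any fun m => m.testBit i && m.testBit j) = true := by decide +kernel
theorem hc5 : LM.length = 210 := by decide +kernel
theorem hc4 : incr L4 = true ∧ good 4 L4 = true ∧ L4.length = 525 := by decide +kernel
theorem hd4 : (LM.all fun n => (subs n).all fun m => T4.find m) = true := by decide +kernel
theorem hc3 : incr L3 = true ∧ good 3 L3 = true ∧ L3.length = 490 := by decide +kernel
theorem hd3 : (L4.all fun n => (subs n).all fun m => T3.find m) = true := by decide +kernel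
theorem hu3 : (L3.all fun n => L4.any fun m => sub n m) = true := by decide +kernel
theorem hball : ∀ x : W, stackOK (ball x) = true ∧ good 5 (ball x) = true ∧
    incr (srt (ball x)) = true ∧ bdryL (srt (ball x)) = linkL LM (code x) := by decide +kernel
theorem hbase : baseA21 = decS LB := by decide +kernel
theorem hrot : ∀ j : ZMod 7, ∀ n ∈ LB, shift7 j (dec n) = dec (rot j.val n) := by decide +kernel

attribute [irreducible] LM T3 T4 L3 L4 LA LB ball

/-! ### soundness -/

theorem code_lt (v : W) : code v < 21 := by
  revert v; decide +kernel

theorem code_inj {v w : W} (h : code v = code w) : v = w := by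
  revert v w; decide +kernel

theorem code_surj : ∀ i < 21, ∃ v : W, code v = i := by decide +kernel

theorem mem_dec {n : ℕ} {v : W} : v ∈ dec n ↔ n.testBit (code v) = true := by simp [dec]

theorem dec_sub {n m : ℕ} (hn : n < 2097152) : dec n ⊆ dec m ↔ sub n m = true := by
  have hs : sub n m = true ↔ n &&& m = n := by simp [sub]
  rw [hs]
  constructor
  · intro h
    apply Nat.eq_of_testBit_eq
    intro i
    rw [Nat.testBit_and]
    by_cases hi : i < 21
    · obtain ⟨v, rfl⟩ := code_surj i hi
      have := @h v
      rw [mem_dec, mem_dec] at this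
      cases h1 : n.testBit (code v) <;> simp_all
    · have : n.testBit i = false := Nat.testBit_lt_two_pow
        (lt_of_lt_of_le hn (le_trans (by norm_num : 2097152 ≤ 2 ^ 21)
          (Nat.pow_le_pow_right (by norm_num) (by omega))))
      simp [this]
  · intro h v hv
    rw [mem_dec] at *
    rw [← h, Nat.testBit_and] at hv
    simp_all

theorem dec_inj {n m : ℕ} (hn : n < 2097152) (hm : m < 2097152) (h : dec n = dec m) : n = m := by
  have h1 := (dec_sub (m := m) hn).1 h.le
  have h2 := (dec_sub (m := n) hm).1 h.ge
  simp only [sub, Nat.beq_eq] at h1 h2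
  rw [Nat.and_comm] at h2
  omega

theorem dec_and (n m : ℕ) : dec (n &&& m) = dec n ∩ dec m := by
  ext v; simp [mem_dec]

theorem dec_card (n : ℕ) : (dec n).card = popc n := by
  have h : (dec n).image code = ((List.range 21).filter fun i => n.testBit i).toFinset := by
    ext i
    simp only [Finset.mem_image, mem_dec, List.mem_toFinset, List.mem_filter, List.mem_range]
    constructor
    · rintro ⟨v, hv, rfl⟩; exact ⟨code_lt v, hv⟩
    · rintro ⟨hi, h⟩
      obtain ⟨v, rfl⟩ := code_surj i hi
      exact ⟨v, h, rfl⟩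
  rw [← Finset.card_image_of_injective (dec n) (fun _ _ => code_inj), h,
    List.toFinset_card_of_nodup (List.nodup_range.filter _)]
  rfl

theorem dec_xor {n : ℕ} {v : W} (h : v ∈ dec n) : dec (n ^^^ 2 ^ code v) = (dec n).erase v := by
  ext w
  rw [mem_dec] at h
  rw [mem_dec, Finset.mem_erase, mem_dec, Nat.testBit_xor, Nat.testBit_two_pow]
  by_cases hw : w = v
  · subst hw; simp [h]
  · have : code v ≠ code w := fun hh => hw (code_inj hh).symm
    simp [this, hw]

theorem mem_subs {n : ℕ} {s : Finset W} :
    (∃ m ∈ subs n, dec m = s) ↔ ∃ v ∈ dec n, s = (dec n).erase v := by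
  simp only [subs, List.mem_map, List.mem_filter, List.mem_range]
  constructor
  · rintro ⟨m, ⟨i, ⟨hi, h⟩, rfl⟩, rfl⟩
    obtain ⟨v, rfl⟩ := code_surj i hi
    exact ⟨v, mem_dec.2 h, dec_xor (mem_dec.2 h)⟩
  · rintro ⟨v, hv, rfl⟩
    exact ⟨_, ⟨code v, ⟨code_lt v, mem_dec.1 hv⟩, rfl⟩, dec_xor hv⟩

theorem mem_ins {x y : ℕ} (t : T) : y ∈ (T.ins x t).toL ↔ y = x ∨ y ∈ t.toL := by
  induction t with
  | nil => simp [T.ins, T.toL]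
  | node l z r ihl ihr =>
    unfold T.ins
    cases h1 : Nat.blt x z
    · cases h2 : Nat.blt z x
      · have : x = z := by
          have h1' : ¬ x < z := fun h => by rw [← Nat.blt_eq, h1] at h; cases h
          have h2' : ¬ z < x := fun h => by rw [← Nat.blt_eq, h2] at h; cases h
          omega
        subst this
        simp [T.toL]
        tauto
      · simp [T.toL, ihr]; tauto
    · simp [T.toL, ihl]; tauto

theorem mem_srt {L : List ℕ} {y : ℕ} : y ∈ srt L ↔ y ∈ L := by
  unfold srt
  induction L with
  | nil => simp [T.toL]
  | cons x L ih => simp [mem_ins, ih]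

theorem decS_srt (L : List ℕ) : decS (srt L) = decS L := by
  ext s; simp [decS, mem_srt]

theorem mem_decS {L : List ℕ} {s : Finset W} : s ∈ decS L ↔ ∃ n ∈ L, dec n = s := by
  simp [decS]

theorem good_iff {k : ℕ} {L : List ℕ} : good k L = true ↔
    ∀ n ∈ L, n < 2097152 ∧ (dec n).card = k := by
  simp [good, dec_card]

theorem good_srt {k : ℕ} {L : List ℕ} (h : good k L = true) : good k (srt L) = true := by
  rw [good_iff] at *
  intro n hn
  exact h n (mem_srt.1 hn)

theorem incr_nodup {L : List ℕ} (h : incr L = true) : L.Nodup := by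
  have h2 : L.IsChain (· < ·) := by
    induction L with
    | nil => simp
    | cons x L ih =>
      cases L with
      | nil => simp
      | cons y L =>
        simp only [incr, Bool.and_eq_true, Nat.blt_eq] at h
        exact List.IsChain.cons_cons h.1 (ih h.2)
  exact (List.isChain_iff_pairwise.1 h2).imp (fun h => ne_of_lt h)

theorem decS_card {k : ℕ} {L : List ℕ} (h : good k L = true) (hi : incr L = true) :
    (decS L).card = L.length := by
  rw [good_iff] at h
  unfold decS
  rw [Finset.card_image_of_injOn, List.toFinset_card_of_nodup (incr_nodup hi)]
  intro x hx y hy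
  simp only [List.coe_toFinset, Set.mem_ofPred_eq] at hx hy
  exact dec_inj (h x hx).1 (h y hy).1

theorem decS_count {k n : ℕ} {L : List ℕ} (h : good k L = true) (hi : incr L = true)
    (hn : n < 2097152) :
    ((decS L).filter fun s => dec n ⊆ s).card = (L.filter fun m => sub n m).length := by
  rw [good_iff] at h
  have : ((decS L).filter fun s => dec n ⊆ s) = (L.filter fun m => sub n m).toFinset.image dec := by
    ext s
    simp only [Finset.mem_filter, mem_decS, Finset.mem_image, List.mem_toFinset, List.mem_filter]
    constructor
    · rintro ⟨⟨m, hm, rfl⟩, hs⟩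
      exact ⟨m, ⟨hm, (dec_sub hn).1 hs⟩, rfl⟩
    · rintro ⟨m, ⟨hm, hs⟩, rfl⟩
      exact ⟨⟨m, hm, rfl⟩, (dec_sub hn).2 hs⟩
  rw [this, Finset.card_image_of_injOn, List.toFinset_card_of_nodup ((incr_nodup hi).filter _)]
  intro x hx y hy
  simp only [List.coe_toFinset, Set.mem_ofPred_eq, List.mem_filter] at hx hy
  exact dec_inj (h x hx.1).1 (h y hy.1).1

theorem xor_lt {n i : ℕ} (hn : n < 2097152) (hi : i < 21) : n ^^^ 2 ^ i < 2097152 := by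
  have h1 : (2097152 : ℕ) = 2 ^ 21 := by norm_num
  rw [h1] at *
  exact Nat.xor_lt_two_pow hn (Nat.pow_lt_pow_right (by norm_num) hi)

theorem good_down {k : ℕ} {L : List ℕ} (h : good (k + 1) L = true) : good k (down L) = true := by
  rw [good_iff] at *
  intro n hn
  simp only [down, mem_srt, List.mem_flatMap] at hn
  obtain ⟨m, hm, hn⟩ := hn
  obtain ⟨v, hv, e⟩ := mem_subs.1 ⟨n, hn, rfl⟩
  refine ⟨?_, ?_⟩
  · simp only [subs, List.mem_map, List.mem_filter, List.mem_range] at hn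
    obtain ⟨i, ⟨hi, -⟩, rfl⟩ := hn
    exact xor_lt (h m hm).1 hi
  · rw [e, Finset.card_erase_of_mem hv, (h m hm).2]; rfl

theorem decS_down {k : ℕ} {L : List ℕ} (h : good (k + 1) L = true) :
    decS (down L) = (decS L).biUnion fun σ => σ.powersetCard k := by
  rw [good_iff] at h
  unfold down
  rw [decS_srt]
  ext s
  simp only [mem_decS, List.mem_flatMap, Finset.mem_biUnion, Finset.mem_powersetCard]
  constructor
  · rintro ⟨n, ⟨m, hm, hn⟩, rfl⟩
    obtain ⟨v, hv, e⟩ := mem_subs.1 ⟨n, hn, rfl⟩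
    refine ⟨dec m, ⟨m, hm, rfl⟩, ?_, ?_⟩
    · rw [e]; exact Finset.erase_subset _ _
    · rw [e, Finset.card_erase_of_mem hv, (h m hm).2]; rfl
  · rintro ⟨_, ⟨m, hm, rfl⟩, hs, hc⟩
    have hm2 := (h m hm).2
    have hd : (dec m \ s).card = 1 := by
      rw [Finset.card_sdiff_of_subset hs]; omega
    obtain ⟨v, hv⟩ := Finset.card_eq_one.1 hd
    have hvm : v ∈ dec m \ s := by rw [hv]; simp
    have hvm' := Finset.mem_sdiff.1 hvm
    have : s = (dec m).erase v := by
      rw [← Finset.sdiff_singleton_eq_erase, ← hv, Finset.sdiff_sdiff_eq_self hs]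
    obtain ⟨n, hn, e⟩ := mem_subs.2 ⟨v, hvm'.1, this⟩
    exact ⟨n, ⟨m, hm, hn⟩, e⟩

theorem mem_find {x : ℕ} (t : T) (h : t.find x = true) : x ∈ t.toL := by
  induction t with
  | nil => cases h
  | node l z r ihl ihr =>
    unfold T.find at h
    cases h1 : Nat.blt x z
    · cases h2 : Nat.blt z x
      · have : x = z := by
          have h1' : ¬ x < z := fun h => by rw [← Nat.blt_eq, h1] at h; cases h
          have h2' : ¬ z < x := fun h => by rw [← Nat.blt_eq, h2] at h; cases h
          omega
        subst this
        simp [T.toL]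
      · rw [h1, h2] at h
        have := ihr h
        simp [T.toL, this]
    · rw [h1] at h
      have := ihl h
      simp [T.toL, this]

theorem L4_mem {x : ℕ} (h : T4.find x = true) : x ∈ L4 := by
  rw [L4_eq]; exact mem_find _ h
theorem L3_mem {x : ℕ} (h : T3.find x = true) : x ∈ L3 := by
  rw [L3_eq]; exact mem_find _ h

theorem decS_faces {k : ℕ} {L L' : List ℕ} (h : good (k + 1) L = true) (h' : good k L' = true)
    (h1 : ∀ n ∈ L, ∀ m ∈ subs n, m ∈ L') (h2 : ∀ m ∈ L', ∃ n ∈ L, sub m n = true) :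
    decS L' = (decS L).biUnion fun σ => σ.powersetCard k := by
  apply subset_antisymm
  · intro s hs
    obtain ⟨m, hm, rfl⟩ := mem_decS.1 hs
    obtain ⟨n, hn, hmn⟩ := h2 m hm
    have hg := good_iff.1 h' m hm
    simp only [Finset.mem_biUnion, Finset.mem_powersetCard]
    exact ⟨dec n, mem_decS.2 ⟨n, hn, rfl⟩, (dec_sub hg.1).2 hmn, hg.2⟩
  · rw [← decS_down h]
    intro s hs
    obtain ⟨m, hm, rfl⟩ := mem_decS.1 hs
    simp only [down, mem_srt, List.mem_flatMap] at hm
    obtain ⟨n, hn, hm⟩ := hm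
    exact mem_decS.2 ⟨m, h1 n hn m hm, rfl⟩

theorem decS_bdry {k : ℕ} {L : List ℕ} (h : good (k + 1) L = true) (hi : incr L = true) :
    bdryFacets k (decS L) = decS (bdryL L) := by
  unfold bdryFacets
  rw [← decS_down h]
  have hd := good_iff.1 (good_down h)
  ext s
  simp only [Finset.mem_filter, mem_decS, bdryL, List.mem_filter, Nat.beq_eq]
  constructor
  · rintro ⟨⟨n, hn, rfl⟩, hs⟩
    rw [decS_count h hi (hd n hn).1] at hs
    exact ⟨n, ⟨hn, hs⟩, rfl⟩
  · rintro ⟨n, ⟨hn, hs⟩, rfl⟩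
    rw [decS_count h hi (hd n hn).1]
    exact ⟨⟨n, hn, rfl⟩, hs⟩

theorem decS_link (L : List ℕ) (x : W) : linkFacets (decS L) x = decS (linkL L (code x)) := by
  unfold linkL
  rw [decS_srt]
  ext s
  simp only [linkFacets, Finset.mem_image, Finset.mem_filter, mem_decS, List.mem_map,
    List.mem_filter]
  constructor
  · rintro ⟨_, ⟨⟨n, hn, rfl⟩, hx⟩, rfl⟩
    exact ⟨_, ⟨n, ⟨hn, mem_dec.1 hx⟩, rfl⟩, dec_xor hx⟩
  · rintro ⟨_, ⟨n, ⟨hn, hx⟩, rfl⟩, rfl⟩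
    exact ⟨_, ⟨⟨n, hn, rfl⟩, mem_dec.2 hx⟩, (dec_xor (mem_dec.2 hx)).symm⟩

theorem and_lt {n m : ℕ} (hn : n < 2097152) : m &&& n < 2097152 :=
  lt_of_le_of_lt Nat.and_le_right hn

theorem stack_sound (L : List ℕ) (h : stackOK L = true) :
    (∀ n ∈ L, n < 2097152) ∧ IsStackedBall 4 (decS L) := by
  induction L with
  | nil => simp [stackOK] at h
  | cons n L ih =>
    simp only [stackOK, Bool.and_eq_true, Bool.or_eq_true, Nat.blt_eq, Nat.beq_eq,
      List.isEmpty_iff, List.any_eq_true, List.all_eq_true, Bool.not_eq_true',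
      List.contains_eq_mem, decide_eq_false_iff_not] at h
    obtain ⟨⟨hn, hp⟩, h⟩ := h
    rcases h with rfl | ⟨hL, hnL, r, hr, hp4, hall⟩
    · refine ⟨by simpa using hn, ?_⟩
      have : decS [n] = {dec n} := by simp [decS]
      rw [this]
      exact IsStackedBall.single 4 _ (by rw [dec_card, hp])
    · obtain ⟨hb, hB⟩ := ih hL
      refine ⟨by simpa using ⟨hn, hb⟩, ?_⟩
      have : decS (n :: L) = insert (dec n) (decS L) := by simp [decS]
      rw [this]
      refine IsStackedBall.glue 4 _ _ (dec (r &&& n)) hB (by rw [dec_card, hp]) ?_ ?_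
        (by rw [dec_card, hp4]) ?_ ?_
      · rw [mem_decS]
        rintro ⟨m, hm, e⟩
        exact hnL (dec_inj (hb m hm) hn e ▸ hm)
      · rw [dec_and]; exact Finset.inter_subset_right
      · refine ⟨dec r, ⟨mem_decS.2 ⟨r, hr, rfl⟩, ?_⟩, ?_⟩
        · rw [dec_and]; exact Finset.inter_subset_left
        · rintro _ ⟨hy, hs⟩
          obtain ⟨q, hq, rfl⟩ := mem_decS.1 hy
          rw [dec_sub (and_lt hn)] at hs
          rcases (hall q hq).2 with h | h
          · rw [h] at hs; cases hs
          · rw [h]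
      · intro ρ hρ
        obtain ⟨q, hq, rfl⟩ := mem_decS.1 hρ
        rw [← dec_and, dec_sub (and_lt hn)]
        exact (hall q hq).1

theorem A21_eq : A21 = decS (srt LA) := by
  rw [decS_srt]
  ext s
  simp only [A21, hbase, Finset.mem_biUnion, Finset.mem_image, mem_decS, LA_eq, List.mem_flatMap,
    List.mem_map, List.mem_range, Finset.mem_univ, true_and]
  constructor
  · rintro ⟨j, _, ⟨n, hn, rfl⟩, rfl⟩
    exact ⟨_, ⟨j.val, ZMod.val_lt j, n, hn, rfl⟩, (hrot j n hn).symm⟩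
  · rintro ⟨_, ⟨j, hj, n, hn, rfl⟩, rfl⟩
    refine ⟨(j : ZMod 7), _, ⟨n, hn, rfl⟩, ?_⟩
    rw [hrot _ n hn, ZMod.val_natCast_of_lt hj]

def MM : Finset (Finset W) := M21
theorem MM_def : M21 = MM := rfl

theorem M21_eq : MM = decS LM := by
  unfold MM M21
  rw [A21_eq, decS_bdry (good_srt hLA_good) hLA_incr.1, hbd]

attribute [irreducible] MM

theorem nbr (x y : W) : ∃ τ ∈ MM, x ∈ τ ∧ y ∈ τ := by
  have h := hnb
  simp only [List.all_eq_true, List.mem_range, List.any_eq_true, Bool.and_eq_true] at h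
  obtain ⟨m, hm, h1, h2⟩ := h _ (code_lt x) _ (code_lt y)
  rw [M21_eq]
  exact ⟨dec m, mem_decS.2 ⟨m, hm, rfl⟩, mem_dec.2 h1, mem_dec.2 h2⟩

theorem vs : vertexSet MM = Finset.univ := by
  ext x
  obtain ⟨τ, h, hx, -⟩ := nbr x x
  simp only [vertexSet, Finset.mem_biUnion, id, Finset.mem_univ, iff_true]
  exact ⟨τ, h, hx⟩

theorem link_ok (x : W) : IsStackedSphere 3 (linkFacets MM x) := by
  obtain ⟨h1, h2, h3, h4⟩ := hball x
  refine ⟨decS (ball x), (stack_sound _ h1).2, ?_⟩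
  rw [← decS_srt (ball x), M21_eq, decS_link, decS_bdry (good_srt h2) h3, h4]

/-- lower faces through faces one dimension up. -/
theorem faces_step (F : Finset (Finset W)) (k : ℕ) (hF : ∀ σ ∈ F, k + 1 ≤ σ.card) :
    (F.biUnion fun σ => σ.powersetCard k) =
      (F.biUnion fun σ => σ.powersetCard (k + 1)).biUnion fun σ => σ.powersetCard k := by
  ext s
  simp only [Finset.mem_biUnion, Finset.mem_powersetCard]
  constructor
  · rintro ⟨σ, hσ, hs, hc⟩
    obtain ⟨u, h1, h2, h3⟩ := Finset.exists_subsuperset_card_eq hs (by omega) (hF σ hσ)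
    exact ⟨u, ⟨σ, hσ, h2, h3⟩, h1, hc⟩
  · rintro ⟨u, ⟨σ, hσ, h2, h3⟩, h1, hc⟩
    exact ⟨σ, hσ, h1.trans h2, hc⟩

theorem card5 : ∀ τ ∈ MM, τ.card = 5 := by
  intro τ h
  rw [M21_eq] at h
  obtain ⟨n, hn, rfl⟩ := mem_decS.1 h
  exact (good_iff.1 hLM_good n hn).2

theorem F5 : (MM.biUnion fun σ => σ.powersetCard 5) = decS LM := by
  rw [← M21_eq]
  ext s
  simp only [Finset.mem_biUnion, Finset.mem_powersetCard]
  constructor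
  · rintro ⟨σ, h, hs, hc⟩
    rw [Finset.eq_of_subset_of_card_le hs (by rw [hc, card5 σ h])]
    exact h
  · intro h
    exact ⟨s, h, subset_rfl, card5 s h⟩

theorem hpm' {n : ℕ} (hn : n ∈ L4) : (LM.filter fun m => sub n m).length ≤ 2 ∧
    1 ≤ (LM.filter fun m => sub n m).length := by
  have h := List.all_eq_true.1 hpm n hn
  rwa [Bool.and_eq_true, Nat.ble_eq, Nat.ble_eq] at h

theorem F4 : (MM.biUnion fun σ => σ.powersetCard 4) = decS L4 := by
  rw [faces_step _ _ (fun σ h => by rw [card5 σ h]), F5, decS_faces hLM_good hc4.2.1]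
  · intro n hn m hm
    exact L4_mem (List.all_eq_true.1 (List.all_eq_true.1 hd4 n hn) m hm)
  · intro m hm
    obtain ⟨n, hn⟩ := List.exists_mem_of_length_pos (hpm' hm).2
    rw [List.mem_filter] at hn
    exact ⟨n, hn⟩

theorem F3 : (MM.biUnion fun σ => σ.powersetCard 3) = decS L3 := by
  rw [faces_step _ _ (fun σ h => by rw [card5 σ h]; norm_num), F4, decS_faces hc4.2.1 hc3.2.1]
  · intro n hn m hm
    exact L3_mem (List.all_eq_true.1 (List.all_eq_true.1 hd3 n hn) m hm)
  · intro m hm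
    exact List.any_eq_true.1 (List.all_eq_true.1 hu3 m hm)

theorem fc5 : faceCount MM 5 = 210 := by
  unfold faceCount; rw [F5, decS_card hLM_good hLM_incr, hc5]
theorem fc4 : faceCount MM 4 = 525 := by
  unfold faceCount; rw [F4, decS_card hc4.2.1 hc4.1, hc4.2.2]
theorem fc3 : faceCount MM 3 = 490 := by
  unfold faceCount; rw [F3, decS_card hc3.2.1 hc3.1, hc3.2.2]
theorem fc2 : faceCount MM 2 = 210 := by
  have : (MM.biUnion fun σ => σ.powersetCard 2) = Finset.univ.powersetCard 2 := by
    ext s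
    simp only [Finset.mem_biUnion, Finset.mem_powersetCard, Finset.subset_univ, true_and]
    constructor
    · rintro ⟨σ, -, -, h⟩; exact h
    · intro h
      obtain ⟨v, w, -, rfl⟩ := Finset.card_eq_two.1 h
      obtain ⟨τ, hτ, hv, hw⟩ := nbr v w
      refine ⟨τ, hτ, ?_, h⟩
      intro u hu
      simp only [Finset.mem_insert, Finset.mem_singleton] at hu
      rcases hu with rfl | rfl <;> assumption
  unfold faceCount
  rw [this, Finset.card_powersetCard]
  simp [Nat.choose]
theorem fc1 : faceCount MM 1 = 21 := by
  have : (MM.biUnion fun σ => σ.powersetCard 1) = Finset.univ.powersetCard 1 := by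
    ext s
    simp only [Finset.mem_biUnion, Finset.mem_powersetCard, Finset.subset_univ, true_and]
    constructor
    · rintro ⟨σ, -, -, h⟩; exact h
    · intro h
      obtain ⟨v, rfl⟩ := Finset.card_eq_one.1 h
      obtain ⟨τ, hτ, hv, -⟩ := nbr v v
      exact ⟨τ, hτ, by simpa using hv, h⟩
  unfold faceCount
  rw [this, Finset.card_powersetCard]
  simp

theorem pm (s : Finset W) (hs : s.card = 4) : (MM.filter fun τ => s ⊆ τ).card ≤ 2 := by
  by_cases h : ∃ τ ∈ MM, s ⊆ τ
  · obtain ⟨τ, hτ, hsτ⟩ := h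
    have : s ∈ decS L4 := by
      rw [← F4]
      simp only [Finset.mem_biUnion, Finset.mem_powersetCard]
      exact ⟨τ, hτ, hsτ, hs⟩
    obtain ⟨n, hn, rfl⟩ := mem_decS.1 this
    rw [M21_eq, decS_count hLM_good hLM_incr (good_iff.1 hc4.2.1 n hn).1]
    exact (hpm' hn).1
  · push Not at h
    rw [Finset.filter_false_of_mem h]
    simp

end P21

/-- The boundary complex is a 2-neighborly 4-dimensional weak
pseudomanifold on 21 vertices, every vertex link is a stacked 3-sphere (so it lies
in the Walkup class `K(4)`), its face vector is (21, 210, 490, 525, 210), and its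
Euler characteristic is χ = (-14), so that `f₀ (f₀ - 11) = -15 χ`. -/
theorem stmt15 :
    (∀ τ ∈ M21, τ.card = 5) ∧
      (∀ s : Finset (Fin 3 × ZMod 7), s.card = 4 → (M21.filter fun τ => s ⊆ τ).card ≤ 2) ∧
      (vertexSet M21).card = 21 ∧
      (∀ x ∈ vertexSet M21, ∀ y ∈ vertexSet M21, ∃ τ ∈ M21, x ∈ τ ∧ y ∈ τ) ∧
      (∀ x ∈ vertexSet M21, IsStackedSphere 3 (linkFacets M21 x)) ∧
      (faceCount M21 1 = 21 ∧ faceCount M21 2 = 210 ∧ faceCount M21 3 = 490 ∧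
        faceCount M21 4 = 525 ∧ faceCount M21 5 = 210) ∧
      ((faceCount M21 1 : ℤ) - faceCount M21 2 + faceCount M21 3 - faceCount M21 4 +
        faceCount M21 5 = (-14)) ∧
      ((faceCount M21 1 : ℤ) * ((faceCount M21 1 : ℤ) - 11) =
        -15 * ((faceCount M21 1 : ℤ) - faceCount M21 2 + faceCount M21 3 -
          faceCount M21 4 + faceCount M21 5)) := by
  rw [P21.MM_def]
  refine ⟨P21.card5, P21.pm, ?_, fun x _ y _ => P21.nbr x y, fun x _ => P21.link_ok x,
    ⟨P21.fc1, P21.fc2, P21.fc3, P21.fc4, P21.fc5⟩, ?_, ?_⟩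
  · rw [P21.vs]; simp
  · rw [P21.fc1, P21.fc2, P21.fc3, P21.fc4, P21.fc5]; norm_num
  · rw [P21.fc1, P21.fc2, P21.fc3, P21.fc4, P21.fc5]; norm_num
end
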